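/- Assume 1/4 < s' ≤ 1, 1/2 < s ≤ 1, max(3/2 − 2s, s/2 − 1/8) < s' < 4s − 3/2, 1/2 < θ₀ < 3/4, and max(1/2, 1 − s') < θ₁ < min(3/4, 4s − s' − 1, 2s − 1/2). Then there exists ε₀ > 0 such that for every ε with 0 < ε ≤ ε₀ there exists a constant C > 0 such that for all Schwartz functions u, v on ℝ^{1+2}, ‖uv‖_{H^{s−1/2, θ₀−1+ε}} ≤ C ‖u‖_{H^{s−1/2, θ₀−1/2}} ‖v‖_{H^{s'+1/2, θ₁}}. -/

import Mathlib

open MeasureTheory Real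
open scoped FourierTransform

noncomputable section

/-- Space-time ℝ^{1+2}: coordinate 0 is time `t`, coordinates 1,2 are space `x`. -/
abbrev SpaceTime := EuclideanSpace ℝ (Fin 3)

/-- The magnitude `|ξ|` of the spatial part of a frequency point `(τ, ξ) ∈ ℝ × ℝ²`. -/
def spFreq (ζ : SpaceTime) : ℝ := Real.sqrt ((ζ 1) ^ 2 + (ζ 2) ^ 2)

/-- The wave-Sobolev norm
`‖u‖_{H^{s,b}} = (∫ (1+|ξ|²)^s (1+||τ|-|ξ||)^{2b} |û(τ,ξ)|² dτ dξ)^{1/2}`. -/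
def waveNorm (s b : ℝ) (f : SpaceTime → ℂ) : ℝ :=
  (∫ ζ : SpaceTime, (1 + (spFreq ζ) ^ 2) ^ s * (1 + |(|ζ 0| - spFreq ζ)|) ^ (2 * b) *
    ‖𝓕 f ζ‖ ^ 2) ^ (1/2 : ℝ)


open Set
open scoped ENNReal NNReal

/-- The Japanese-bracket weight `(1 + |x|)^(-p)` as an extended nonnegative number. -/
def jap (p x : ℝ) : ℝ≥0∞ := ENNReal.ofReal ((1 + |x|) ^ (-p))

@[fun_prop]
lemma measurable_jap (p : ℝ) : Measurable (jap p) := by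
  unfold jap; fun_prop

lemma jap_le_one {p : ℝ} (hp : 0 ≤ p) (x : ℝ) : jap p x ≤ 1 := by
  unfold jap
  rw [ENNReal.ofReal_le_one]
  exact Real.rpow_le_one_of_one_le_of_nonpos (by linarith [abs_nonneg x]) (by linarith)

lemma jap_neg (p x : ℝ) : jap p (-x) = jap p x := by simp [jap]

lemma jap_abs_sub_le (p x A : ℝ) : jap p (|x| - A) ≤ jap p (x - A) + jap p (x + A) := by
  rcases abs_cases x with ⟨h, _⟩ | ⟨h, _⟩
  · rw [h]; exact le_self_add
  · rw [h, show -x - A = -(x + A) by ring, jap_neg]; exact le_add_self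

lemma exists_lintegral_jap_le {p : ℝ} (hp : 1 < p) :
    ∃ C : ℝ≥0, ∀ c : ℝ, ∫⁻ x, jap p (x - c) ≤ C := by
  have h := finite_integral_one_add_norm (E := ℝ) (μ := volume) (r := p) (by simpa using hp)
  refine ⟨(∫⁻ x, jap p x).toNNReal, fun c => ?_⟩
  rw [lintegral_sub_right_eq_self (fun x => jap p x) c, ENNReal.coe_toNNReal]
  exact h.ne

lemma exists_lintegral_jap_abs_sub_le {p : ℝ} (hp : 1 < p) :
    ∃ C : ℝ≥0, ∀ c A : ℝ, ∫⁻ x, jap p (|x - c| - A) ≤ C := by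
  obtain ⟨C, hC⟩ := exists_lintegral_jap_le hp
  refine ⟨C + C, fun c A => ?_⟩
  calc ∫⁻ x, jap p (|x - c| - A) ≤ ∫⁻ x, (jap p (x - (c + A)) + jap p (x - (c - A))) := by
        refine lintegral_mono fun x => (jap_abs_sub_le p (x - c) A).trans_eq ?_
        congr 2 <;> ring
    _ ≤ (C + C : ℝ≥0) := by
        rw [lintegral_add_left (by fun_prop)]
        push_cast
        exact add_le_add (hC _) (hC _)

/-- The singular weight `|x|^(-1/2)`. -/
def isqrt (x : ℝ) : ℝ≥0∞ := ENNReal.ofReal (|x| ^ (-(1/2) : ℝ))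

@[fun_prop]
lemma measurable_isqrt : Measurable isqrt := by
  unfold isqrt; fun_prop

lemma isqrt_le_two_mul_jap {u : ℝ} (hu : 1 ≤ |u|) : isqrt u ≤ 2 * jap (1/2) u := by
  unfold isqrt jap
  rw [show (2 : ℝ≥0∞) = ENNReal.ofReal 2 by simp, ← ENNReal.ofReal_mul (by norm_num)]
  apply ENNReal.ofReal_le_ofReal
  have h2 : (1 + |u|) ^ (-(1/2) : ℝ) ≥ (4 * |u|) ^ (-(1/2) : ℝ) :=
    Real.rpow_le_rpow_of_nonpos (by linarith) (by linarith) (by norm_num)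
  rw [Real.mul_rpow (by norm_num) (by positivity)] at h2
  have h3 : (4 : ℝ) ^ (-(1/2) : ℝ) = 1/2 := by
    rw [show (4 : ℝ) = 2 ^ (2 : ℝ) by norm_num, ← Real.rpow_mul (by norm_num)]
    norm_num [Real.rpow_neg_one]
  rw [h3] at h2
  linarith

lemma isqrt_mul_jap_le {k : ℝ} (hk : 0 ≤ k) (u v : ℝ) :
    isqrt u * jap k v ≤ (Metric.ball (0 : ℝ) 1).indicator isqrt u +
      2 * (jap (1/2 + k) u + jap (1/2 + k) v) := by
  by_cases hu : u ∈ Metric.ball (0 : ℝ) 1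
  · rw [indicator_of_mem hu]
    exact (mul_le_of_le_one_right' (jap_le_one hk v)).trans le_self_add
  · rw [indicator_of_notMem hu, zero_add]
    simp only [Metric.mem_ball, dist_zero_right, Real.norm_eq_abs, not_lt] at hu
    have h1 := isqrt_le_two_mul_jap hu
    have h4 : jap (1/2) u * jap k v ≤ jap (1/2 + k) u + jap (1/2 + k) v := by
      have key : ∀ w : ℝ, jap (1/2) w * jap k w = jap (1/2 + k) w := fun w => by
        unfold jap
        rw [← ENNReal.ofReal_mul (by positivity), ← Real.rpow_add (by positivity)]
        ring_nf
      have mono : ∀ q, 0 ≤ q → ∀ x y : ℝ, |x| ≤ |y| → jap q y ≤ jap q x := fun q hq x y h =>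
        ENNReal.ofReal_le_ofReal
          (Real.rpow_le_rpow_of_nonpos (by positivity) (by linarith) (by linarith))
      rcases le_total |u| |v| with h | h
      · exact ((mul_le_mul_right (mono k hk _ _ h) _).trans_eq (key u)).trans le_self_add
      · exact ((mul_le_mul_left (mono (1/2) (by norm_num) _ _ h) _).trans_eq (key v)).trans
          le_add_self
    calc isqrt u * jap k v ≤ 2 * jap (1/2) u * jap k v := mul_le_mul_left h1 _
      _ = 2 * (jap (1/2) u * jap k v) := mul_assoc _ _ _
      _ ≤ _ := mul_le_mul_right h4 _

lemma lintegral_indicator_isqrt_lt_top :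
    ∫⁻ x, (Metric.ball (0 : ℝ) 1).indicator isqrt x < ∞ := by
  rw [lintegral_indicator Metric.isOpen_ball.measurableSet]
  have h := (MeasureTheory.integrableOn_fun_norm_addHaar (volume : Measure ℝ) (r := 1)
    (f := fun y : ℝ => y ^ (-(1/2) : ℝ))).2 (by
      simp only [Module.finrank_self, tsub_self, pow_zero, one_smul]
      exact (intervalIntegral.integrableOn_Ioo_rpow_iff one_pos).2 (by norm_num))
  exact (hasFiniteIntegral_iff_ofReal (by filter_upwards with x; positivity)).1 h.2

lemma exists_lintegral_isqrt_mul_jap_le {k : ℝ} (hk : 1/2 < k) :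
    ∃ C : ℝ≥0, ∀ e c : ℝ, ∫⁻ x, isqrt (x - e) * jap k (x - c) ≤ C := by
  obtain ⟨C, hC⟩ := exists_lintegral_jap_le (p := 1/2 + k) (by linarith)
  have hfin := lintegral_indicator_isqrt_lt_top
  refine ⟨(∫⁻ x, (Metric.ball (0 : ℝ) 1).indicator isqrt x).toNNReal + 2 * (C + C),
    fun e c => ?_⟩
  have hm : Measurable ((Metric.ball (0 : ℝ) 1).indicator isqrt) :=
    measurable_isqrt.indicator Metric.isOpen_ball.measurableSet
  have hmc : ∀ e : ℝ, Measurable fun x => (Metric.ball (0 : ℝ) 1).indicator isqrt (x - e) :=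
    fun e => hm.comp (measurable_id.sub_const e)
  push_cast
  rw [ENNReal.coe_toNNReal hfin.ne]
  calc ∫⁻ x, isqrt (x - e) * jap k (x - c)
      ≤ ∫⁻ x, ((Metric.ball (0 : ℝ) 1).indicator isqrt (x - e) +
        2 * (jap (1/2 + k) (x - e) + jap (1/2 + k) (x - c))) :=
        lintegral_mono fun x => isqrt_mul_jap_le (by linarith) _ _
    _ ≤ _ := by
        rw [lintegral_add_left (hmc e),
          lintegral_const_mul _ (by fun_prop), lintegral_add_left (by fun_prop),
          lintegral_sub_right_eq_self (fun x => (Metric.ball (0 : ℝ) 1).indicator isqrt x) e]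
        gcongr <;> exact hC _

lemma isqrt_antitone {x y : ℝ} (hx : 0 < x) (h : x ≤ y) : isqrt y ≤ isqrt x := by
  unfold isqrt
  rw [abs_of_pos hx, abs_of_pos (hx.trans_le h)]
  exact ENNReal.ofReal_le_ofReal (Real.rpow_le_rpow_of_nonpos hx h (by norm_num))

lemma isqrt_neg (x : ℝ) : isqrt (-x) = isqrt x := by simp [isqrt]

lemma isqrt_mul_isqrt_le {u v m : ℝ} (hm : 0 < m) (huv : u + v = 2 * m) :
    isqrt u * isqrt v ≤ isqrt m * (isqrt u + isqrt v) := by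
  rw [mul_add]
  rcases le_total m u with h | h
  · exact (mul_le_mul_left (isqrt_antitone hm h) _).trans le_add_self
  · rw [mul_comm]
    exact (mul_le_mul_left (isqrt_antitone hm (by linarith)) _).trans le_self_add

/-- The distance from a point at distance `P` from the origin to a point on the circle of radius
`r`, in terms of the angle `θ`. -/
def chord (P r θ : ℝ) : ℝ := √(P ^ 2 + r ^ 2 + 2 * P * r * Real.cos θ)

@[fun_prop]
lemma measurable_chord (P r : ℝ) : Measurable (chord P r) := by
  unfold chord; fun_prop

lemma chord_arg_pos {P r θ : ℝ} (hP : 0 < P) (hr : 0 < r) (hθ : θ ∈ Ioo 0 π) :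
    0 < P ^ 2 + r ^ 2 + 2 * P * r * Real.cos θ := by
  have h1 : -1 < Real.cos θ := by
    rw [← Real.cos_pi]
    exact Real.cos_lt_cos_of_nonneg_of_le_pi hθ.1.le le_rfl hθ.2
  nlinarith [sq_nonneg (P - r), mul_pos hP hr]

lemma chord_pos {P r θ : ℝ} (hP : 0 < P) (hr : 0 < r) (hθ : θ ∈ Ioo 0 π) : 0 < chord P r θ :=
  Real.sqrt_pos.2 (chord_arg_pos hP hr hθ)

lemma chord_sq {P r θ : ℝ} (hP : 0 < P) (hr : 0 < r) (hθ : θ ∈ Ioo 0 π) :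
    chord P r θ ^ 2 = P ^ 2 + r ^ 2 + 2 * P * r * Real.cos θ :=
  Real.sq_sqrt (chord_arg_pos hP hr hθ).le

lemma chord_mem {P r θ : ℝ} (hP : 0 < P) (hr : 0 < r) (hθ : θ ∈ Ioo 0 π) :
    chord P r θ ∈ Ioo |P - r| (P + r) := by
  have h1 : -1 < Real.cos θ := by
    rw [← Real.cos_pi]
    exact Real.cos_lt_cos_of_nonneg_of_le_pi hθ.1.le le_rfl hθ.2
  have h2 : Real.cos θ < 1 := by
    rw [← Real.cos_zero]
    exact Real.cos_lt_cos_of_nonneg_of_le_pi le_rfl hθ.2.le hθ.1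
  have h3 := chord_sq hP hr hθ
  have h4 := mul_pos hP hr
  constructor
  · refine abs_lt_of_sq_lt_sq ?_ (chord_pos hP hr hθ).le
    rw [h3]; nlinarith
  · refine lt_of_pow_lt_pow_left₀ 2 (by positivity) ?_
    rw [h3]; nlinarith

lemma hasDerivAt_chord {P r θ : ℝ} (hP : 0 < P) (hr : 0 < r) (hθ : θ ∈ Ioo 0 π) :
    HasDerivAt (chord P r) (-(P * r * Real.sin θ / chord P r θ)) θ := by
  have h := (((Real.hasDerivAt_cos θ).const_mul (2 * P * r)).const_add (P ^ 2 + r ^ 2)).sqrt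
    (chord_arg_pos hP hr hθ).ne'
  have hc := (chord_pos hP hr hθ).ne'
  refine h.congr_deriv ?_
  change 2 * P * r * -Real.sin θ / (2 * chord P r θ) = _
  field_simp

lemma injOn_chord {P r : ℝ} (hP : 0 < P) (hr : 0 < r) : InjOn (chord P r) (Ioo 0 π) := by
  intro x hx y hy h
  have h1 := chord_sq hP hr hx
  rw [h, chord_sq hP hr hy] at h1
  have h2 : 2 * P * r ≠ 0 := by positivity
  have h3 : Real.cos x = Real.cos y := mul_left_cancel₀ h2 (by linarith)
  exact Real.injOn_cos (Ioo_subset_Icc_self hx) (Ioo_subset_Icc_self hy) h3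

lemma one_le_deriv_chord_mul {P r θ : ℝ} (hP : 0 < P) (hr : 0 < r) (hθ : θ ∈ Ioo 0 π) :
    1 ≤ ENNReal.ofReal |(-(P * r * Real.sin θ / chord P r θ))| *
      (2 * (isqrt (P + r - chord P r θ) * isqrt (chord P r θ - |P - r|))) := by
  have hs : 0 < Real.sin θ := Real.sin_pos_of_mem_Ioo hθ
  have hD := chord_pos hP hr hθ
  have hD2 := chord_sq hP hr hθ
  obtain ⟨hm1, hm2⟩ := chord_mem hP hr hθ
  have hsc := Real.sin_sq_add_cos_sq θ
  have hq := sq_abs (P - r)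
  have hq0 := abs_nonneg (P - r)
  generalize chord P r θ = D at *
  generalize |P - r| = q at *
  have hu : 0 < P + r - D := by linarith
  have hv : 0 < D - q := by linarith
  unfold isqrt
  rw [abs_neg, abs_of_pos (by positivity), abs_of_pos hu, abs_of_pos hv,
    ← ENNReal.ofReal_mul (by positivity), show (2 : ℝ≥0∞) = ENNReal.ofReal 2 by simp,
    ← ENNReal.ofReal_mul (by norm_num), ← ENNReal.ofReal_mul (by positivity),
    ENNReal.one_le_ofReal, ← Real.mul_rpow hu.le hv.le, Real.rpow_neg (by positivity),
    ← Real.sqrt_eq_rpow]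
  have h1 : √((P + r - D) * (D - q)) ≤ P * r * Real.sin θ / D * 2 := by
    refine Real.sqrt_le_iff.2 ⟨by positivity, ?_⟩
    have e1 : (P * r * Real.sin θ / D * 2) ^ 2 = (4 * (P * r) ^ 2 * Real.sin θ ^ 2) / D ^ 2 := by
      field_simp; ring
    rw [e1, le_div_iff₀ (by positivity)]
    have e2 : 4 * (P * r) ^ 2 * Real.sin θ ^ 2 = ((P + r) ^ 2 - D ^ 2) * (D ^ 2 - q ^ 2) := by
      rw [hD2, hq, show Real.sin θ ^ 2 = 1 - Real.cos θ ^ 2 by linarith]; ring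
    have e3 : ((P + r) ^ 2 - D ^ 2) * (D ^ 2 - q ^ 2) =
        (P + r - D) * (D - q) * ((P + r + D) * (D + q)) := by ring
    rw [e2, e3]
    refine mul_le_mul_of_nonneg_left ?_ (by positivity)
    nlinarith
  have h2 : 0 < √((P + r - D) * (D - q)) := Real.sqrt_pos.2 (by positivity)
  rw [← mul_assoc, ← div_eq_mul_inv, le_div_iff₀ h2]
  linarith

lemma exists_lintegral_chord_le {k : ℝ} (hk : 1/2 < k) :
    ∃ C : ℝ≥0, ∀ P r c : ℝ, 0 < P → 0 < r →
      ∫⁻ θ in Ioo 0 π, jap k (chord P r θ - c) ≤ C * isqrt (min P r) := by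
  obtain ⟨C, hC⟩ := exists_lintegral_isqrt_mul_jap_le hk
  refine ⟨2 * (C + C), fun P r c hP hr => ?_⟩
  set g : ℝ → ℝ≥0∞ := fun x => 2 * (isqrt (P + r - x) * isqrt (x - |P - r|)) * jap k (x - c)
    with hg
  have hm : 0 < min P r := lt_min hP hr
  have hsum : P + r - |P - r| = 2 * min P r := by
    rcases le_total P r with h | h
    · rw [min_eq_left h, abs_of_nonpos (by linarith)]; ring
    · rw [min_eq_right h, abs_of_nonneg (by linarith)]; ring
  calc ∫⁻ θ in Ioo 0 π, jap k (chord P r θ - c)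
      ≤ ∫⁻ θ in Ioo 0 π, ENNReal.ofReal |(-(P * r * Real.sin θ / chord P r θ))| *
          g (chord P r θ) := by
        refine setLIntegral_mono' measurableSet_Ioo fun θ hθ => ?_
        rw [hg, ← mul_assoc]
        exact le_mul_of_one_le_left' (one_le_deriv_chord_mul hP hr hθ)
    _ = ∫⁻ x in chord P r '' Ioo 0 π, g x :=
        (lintegral_image_eq_lintegral_abs_deriv_mul measurableSet_Ioo
          (fun θ hθ => (hasDerivAt_chord hP hr hθ).hasDerivWithinAt) (injOn_chord hP hr) g).symm
    _ ≤ ∫⁻ x, g x := setLIntegral_le_lintegral _ _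
    _ ≤ ∫⁻ x, 2 * isqrt (min P r) * (isqrt (x - (P + r)) * jap k (x - c) +
          isqrt (x - |P - r|) * jap k (x - c)) := by
        refine lintegral_mono fun x => ?_
        have h1 := isqrt_mul_isqrt_le (u := P + r - x) (v := x - |P - r|) hm (by linarith)
        calc g x ≤ 2 * (isqrt (min P r) * (isqrt (P + r - x) + isqrt (x - |P - r|))) *
              jap k (x - c) := mul_le_mul_left (mul_le_mul_right h1 2) _
          _ = _ := by
            rw [← isqrt_neg (P + r - x), neg_sub]; ring
    _ ≤ _ := by
        rw [lintegral_const_mul _ (by fun_prop), lintegral_add_left (by fun_prop)]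
        calc _ ≤ 2 * isqrt (min P r) * (C + C) :=
              mul_le_mul_right (add_le_add (hC _ _) (hC _ _)) _
          _ = _ := by push_cast; ring

lemma lintegral_cos_shift (g : ℝ → ℝ≥0∞) (φ : ℝ) :
    ∫⁻ θ in Ioo (-π) π, g (Real.cos (θ - φ)) ≤ 2 * ∫⁻ θ in Ioo 0 π, g (Real.cos θ) := by
  have hpi := Real.pi_pos
  have h1 : ∫⁻ θ in Ioc (-π) π, g (Real.cos (θ - φ)) =
      ∫⁻ θ in Ioc (-π - φ) (π - φ), g (Real.cos θ) := by
    have := (measurePreserving_sub_right volume φ).setLIntegral_comp_preimage_emb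
      (MeasurableEquiv.subRight φ).measurableEmbedding (fun θ => g (Real.cos θ))
      (Ioc (-π - φ) (π - φ))
    rw [← this]
    congr 2
    ext x; simp
  have h2 : ∫⁻ θ in Ioc (-π - φ) (π - φ), g (Real.cos θ) =
      ∫⁻ θ in Ioc (-π) π, g (Real.cos θ) := by
    have e1 := isAddFundamentalDomain_Ioc Real.two_pi_pos (-π - φ)
    have e2 := isAddFundamentalDomain_Ioc Real.two_pi_pos (-π)
    rw [show -π - φ + 2 * π = π - φ by ring] at e1
    rw [show -π + 2 * π = π by ring] at e2
    refine e1.setLIntegral_eq e2 _ ?_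
    rintro ⟨t, n, rfl⟩ x
    change g (Real.cos (n • (2 * π) + x)) = _
    rw [add_comm, zsmul_eq_mul, Real.cos_add_int_mul_two_pi]
  have h3 : ∫⁻ θ in Ioo (-π) 0, g (Real.cos θ) = ∫⁻ θ in Ioo 0 π, g (Real.cos θ) := by
    have := (Measure.measurePreserving_neg (volume : Measure ℝ)).setLIntegral_comp_preimage_emb
      (MeasurableEquiv.neg ℝ).measurableEmbedding (fun θ => g (Real.cos θ)) (Ioo 0 π)
    rw [← this]
    simp
  calc ∫⁻ θ in Ioo (-π) π, g (Real.cos (θ - φ))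
      ≤ ∫⁻ θ in Ioc (-π) π, g (Real.cos (θ - φ)) := lintegral_mono_set Ioo_subset_Ioc_self
    _ = ∫⁻ θ in Ioc (-π) 0 ∪ Ioc 0 π, g (Real.cos θ) := by
        rw [h1, h2, Ioc_union_Ioc_eq_Ioc (by linarith) hpi.le]
    _ ≤ (∫⁻ θ in Ioc (-π) 0, g (Real.cos θ)) + ∫⁻ θ in Ioc 0 π, g (Real.cos θ) :=
        lintegral_union_le _ _ _
    _ = 2 * ∫⁻ θ in Ioo 0 π, g (Real.cos θ) := by
        rw [setLIntegral_congr (Ioo_ae_eq_Ioc (a := -π) (b := 0)).symm,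
          setLIntegral_congr (Ioo_ae_eq_Ioc (a := 0) (b := π)).symm, h3, two_mul]

lemma exists_lintegral_angle_le {k : ℝ} (hk : 1/2 < k) :
    ∃ C : ℝ≥0, ∀ p q r c : ℝ, 0 ≤ r →
      ∫⁻ θ in Ioo (-π) π, jap k (√((p + r * Real.cos θ) ^ 2 + (q + r * Real.sin θ) ^ 2) - c) ≤
        C * jap (1/2) (min (√(p ^ 2 + q ^ 2)) r) := by
  obtain ⟨C, hC⟩ := exists_lintegral_chord_le hk
  refine ⟨max (4 * π).toNNReal (4 * C), fun p q r c hr => ?_⟩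
  set P := √(p ^ 2 + q ^ 2) with hP
  have hP0 : 0 ≤ P := Real.sqrt_nonneg _
  rcases le_total (min P r) 1 with hm | hm
  · have h1 : 1 ≤ 2 * jap (1/2) (min P r) := by
      unfold jap
      rw [show (2 : ℝ≥0∞) = ENNReal.ofReal 2 by simp, ← ENNReal.ofReal_mul (by norm_num),
        ENNReal.one_le_ofReal, abs_of_nonneg (le_min hP0 hr), Real.rpow_neg (by positivity),
        ← Real.sqrt_eq_rpow, ← div_eq_mul_inv]
      have h0 := le_min hP0 hr
      rw [le_div_iff₀ (Real.sqrt_pos.2 (by linarith)), one_mul, Real.sqrt_le_iff]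
      constructor <;> linarith
    calc _ ≤ ∫⁻ θ in Ioo (-π) π, 1 := lintegral_mono fun θ => jap_le_one (by linarith) _
      _ = ENNReal.ofReal (2 * π) := by
        rw [setLIntegral_one, Real.volume_Ioo]; congr 1; ring
      _ ≤ ENNReal.ofReal (2 * π) * (2 * jap (1/2) (min P r)) := le_mul_of_one_le_right' h1
      _ = ENNReal.ofReal (4 * π) * jap (1/2) (min P r) := by
        rw [← mul_assoc]
        congr 1
        rw [show (2 : ℝ≥0∞) = ENNReal.ofReal 2 by simp, ← ENNReal.ofReal_mul (by positivity)]
        congr 1; ring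
      _ ≤ _ := by
        gcongr
        exact ENNReal.coe_le_coe.2 (le_max_left _ _)
  · have hP1 : 0 < P := lt_of_lt_of_le one_pos (hm.trans (min_le_left _ _))
    have hr1 : 0 < r := lt_of_lt_of_le one_pos (hm.trans (min_le_right _ _))
    set φ := Complex.arg ⟨p, q⟩
    have hz : ‖(⟨p, q⟩ : ℂ)‖ = P := by rw [hP, Complex.norm_eq_sqrt_sq_add_sq]
    have hp : p = P * Real.cos φ := by
      rw [← hz]; exact (Complex.norm_mul_cos_arg ⟨p, q⟩).symm
    have hq : q = P * Real.sin φ := by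
      rw [← hz]; exact (Complex.norm_mul_sin_arg ⟨p, q⟩).symm
    have hch : ∀ θ, √((p + r * Real.cos θ) ^ 2 + (q + r * Real.sin θ) ^ 2) =
        √(P ^ 2 + r ^ 2 + 2 * P * r * Real.cos (θ - φ)) := fun θ => by
      rw [hp, hq, Real.cos_sub]
      congr 1
      linear_combination P ^ 2 * Real.sin_sq_add_cos_sq φ + r ^ 2 * Real.sin_sq_add_cos_sq θ
    calc _ = ∫⁻ θ in Ioo (-π) π,
            jap k (√(P ^ 2 + r ^ 2 + 2 * P * r * Real.cos (θ - φ)) - c) := by simp_rw [hch]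
      _ ≤ 2 * ∫⁻ θ in Ioo 0 π, jap k (chord P r θ - c) :=
        lintegral_cos_shift (fun t => jap k (√(P ^ 2 + r ^ 2 + 2 * P * r * t) - c)) φ
      _ ≤ 2 * (C * (2 * jap (1/2) (min P r))) := by
        gcongr
        refine (hC P r c hP1 hr1).trans ?_
        gcongr
        exact isqrt_le_two_mul_jap (hm.trans (le_abs_self _))
      _ = ((4 * C : ℝ≥0) : ℝ≥0∞) * jap (1/2) (min P r) := by push_cast; ring
      _ ≤ _ := by
        gcongr
        exact le_max_right _ _

/-- The space-time point with time coordinate `τ` and polar spatial coordinates `(r, θ)`. -/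
def polarPoint (r τ θ : ℝ) : SpaceTime := !₂[τ, r * Real.cos θ, r * Real.sin θ]

lemma lintegral_spaceTime_eq_prod (f : SpaceTime → ℝ≥0∞) (hf : Measurable f) :
    ∫⁻ ζ, f ζ = ∫⁻ z : ℝ × ℝ, ∫⁻ τ : ℝ, f !₂[τ, z.1, z.2] := by
  have e1 := (PiLp.volume_preserving_toLp (Fin 3)).lintegral_comp hf
  have hf' : Measurable fun x : Fin 3 → ℝ => f (WithLp.toLp 2 x) :=
    hf.comp (PiLp.volume_preserving_toLp (Fin 3)).measurable
  have e2 := (volume_preserving_piFinSuccAbove (fun _ : Fin 3 => ℝ) 0).symm.lintegral_comp hf'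
  rw [← e1, ← e2, Measure.volume_eq_prod, lintegral_prod_symm]
  · have hf'' : Measurable fun y : Fin 2 → ℝ => ∫⁻ x : ℝ, f (WithLp.toLp 2
        ((MeasurableEquiv.piFinSuccAbove (fun _ : Fin 3 => ℝ) 0).symm (x, y))) := by
      apply Measurable.lintegral_prod_left'
        (f := fun p : ℝ × (Fin 2 → ℝ) => f (WithLp.toLp 2
        ((MeasurableEquiv.piFinSuccAbove (fun _ : Fin 3 => ℝ) 0).symm p)))
      fun_prop
    have e3 := (volume_preserving_finTwoArrow ℝ).symm.lintegral_comp hf''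
    rw [← e3]
    refine lintegral_congr fun z => lintegral_congr fun τ => ?_
    congr 2
    ext i
    fin_cases i <;> rfl
  · exact (hf'.comp
      (MeasurableEquiv.piFinSuccAbove (fun _ : Fin 3 => ℝ) 0).symm.measurable).aemeasurable

@[fun_prop]
lemma measurable_polarPoint :
    Measurable fun p : ℝ × ℝ × ℝ => polarPoint p.1 p.2.1 p.2.2 := by
  unfold polarPoint
  refine (PiLp.volume_preserving_toLp (Fin 3)).measurable.comp (measurable_pi_iff.2 fun i => ?_)
  fin_cases i
  · exact measurable_snd.fst
  · exact (by fun_prop : Measurable fun p : ℝ × ℝ × ℝ => p.1 * Real.cos p.2.2)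
  · exact (by fun_prop : Measurable fun p : ℝ × ℝ × ℝ => p.1 * Real.sin p.2.2)

lemma lintegral_spaceTime_polar (f : SpaceTime → ℝ≥0∞) (hf : Measurable f) :
    ∫⁻ ζ, f ζ = ∫⁻ r in Ioi (0 : ℝ), ENNReal.ofReal r *
      ∫⁻ θ in Ioo (-π) π, ∫⁻ τ : ℝ, f (polarPoint r τ θ) := by
  rw [lintegral_spaceTime_eq_prod f hf, ← lintegral_comp_polarCoord_symm, polarCoord_target,
    Measure.volume_eq_prod, ← Measure.prod_restrict, lintegral_prod]
  · refine lintegral_congr fun r => ?_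
    simp only [polarCoord_symm_apply, smul_eq_mul]
    rw [lintegral_const_mul]
    · rfl
    · apply Measurable.lintegral_prod_right' (f := fun p : ℝ × ℝ => f (polarPoint r p.2 p.1))
      fun_prop
  · apply Measurable.aemeasurable
    refine measurable_fst.ennreal_ofReal.mul ?_
    apply Measurable.lintegral_prod_right'
      (f := fun p : (ℝ × ℝ) × ℝ => f (polarPoint p.1.1 p.2 p.1.2))
    fun_prop

lemma spFreq_polarPoint {r : ℝ} (hr : 0 ≤ r) (τ θ : ℝ) : spFreq (polarPoint r τ θ) = r := by
  have : (r * Real.cos θ) ^ 2 + (r * Real.sin θ) ^ 2 = r ^ 2 := by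
    linear_combination r ^ 2 * Real.sin_sq_add_cos_sq θ
  simp [spFreq, polarPoint, this, Real.sqrt_sq hr]

lemma polarPoint_time (r τ θ : ℝ) : polarPoint r τ θ 0 = τ := rfl

lemma spFreq_add_polarPoint (x : SpaceTime) (r τ θ : ℝ) :
    spFreq (x + polarPoint r τ θ) =
      √((x 1 + r * Real.cos θ) ^ 2 + (x 2 + r * Real.sin θ) ^ 2) := by
  simp [spFreq, polarPoint]

@[fun_prop]
lemma measurable_spFreq : Measurable spFreq := by
  unfold spFreq; fun_prop

/-- The weight `(1 + ||τ| - |ξ||)^(-p)` measuring the distance to the light cone. -/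
def coneJap (p : ℝ) (ζ : SpaceTime) : ℝ≥0∞ := jap p (|ζ 0| - spFreq ζ)

@[fun_prop]
lemma measurable_coneJap (p : ℝ) : Measurable (coneJap p) := by
  unfold coneJap; fun_prop

/-- Integrating two light-cone weights in polar coordinates gains the half power of the smaller of
the two frequencies. -/
lemma exists_lintegral_coneJap_mul_le {b k : ℝ} (hb : 1 < b) (hk : 1/2 < k) :
    ∃ C : ℝ≥0, ∀ (x : SpaceTime) (φ : ℝ → ℝ≥0∞), Measurable φ →
      ∫⁻ y, φ (spFreq y) * (coneJap b y * coneJap k (x + y)) ≤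
        C * ∫⁻ r in Ioi (0 : ℝ), ENNReal.ofReal r * (φ r * jap (1/2) (min (spFreq x) r)) := by
  obtain ⟨C₁, hC₁⟩ := exists_lintegral_jap_abs_sub_le hb
  obtain ⟨C₂, hC₂⟩ := exists_lintegral_angle_le hk
  refine ⟨C₂ * C₁, fun x φ hφ => ?_⟩
  have hm : Measurable fun y => φ (spFreq y) * (coneJap b y * coneJap k (x + y)) := by fun_prop
  rw [lintegral_spaceTime_polar _ hm, ← lintegral_const_mul]
  swap
  · unfold jap; fun_prop
  refine setLIntegral_mono' measurableSet_Ioi fun r (hr : 0 < r) => ?_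
  rw [mul_left_comm]
  gcongr
  calc ∫⁻ θ in Ioo (-π) π, ∫⁻ τ : ℝ, φ (spFreq (polarPoint r τ θ)) *
          (coneJap b (polarPoint r τ θ) * coneJap k (x + polarPoint r τ θ))
      = ∫⁻ τ : ℝ, ∫⁻ θ in Ioo (-π) π, φ (spFreq (polarPoint r τ θ)) *
          (coneJap b (polarPoint r τ θ) * coneJap k (x + polarPoint r τ θ)) := by
        apply lintegral_lintegral_swap
        apply Measurable.aemeasurable
        change Measurable fun p : ℝ × ℝ => _
        have : Measurable fun p : ℝ × ℝ => polarPoint r p.2 p.1 := by fun_prop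
        exact hm.comp this
    _ ≤ ∫⁻ τ : ℝ, φ r * jap b (|τ - 0| - r) * (C₂ * jap (1/2) (min (spFreq x) r)) := by
        refine lintegral_mono fun τ => ?_
        calc _ = ∫⁻ θ in Ioo (-π) π, φ r * jap b (|τ - 0| - r) *
              jap k (√((x 1 + r * Real.cos θ) ^ 2 + (x 2 + r * Real.sin θ) ^ 2) - |x 0 + τ|) := by
              refine lintegral_congr fun θ => ?_
              simp only [coneJap, spFreq_polarPoint hr.le, spFreq_add_polarPoint, PiLp.add_apply,
                polarPoint_time, sub_zero]
              rw [← jap_neg k, neg_sub, mul_assoc]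
          _ ≤ _ := by
              rw [lintegral_const_mul _ (by fun_prop)]
              gcongr
              exact hC₂ _ _ _ _ hr.le
    _ ≤ C₂ * C₁ * (φ r * jap (1/2) (min (spFreq x) r)) := by
        rw [lintegral_mul_const _ (by fun_prop), lintegral_const_mul _ (by fun_prop)]
        calc _ ≤ φ r * C₁ * (C₂ * jap (1/2) (min (spFreq x) r)) := by gcongr; exact hC₁ _ _
          _ = _ := by ring
    _ = _ := by push_cast; ring

lemma exists_lintegral_coneJap_sub_le {b : ℝ} (hb : 1 < b) :
    ∃ C : ℝ≥0, ∀ (z : SpaceTime) (φ : ℝ → ℝ≥0∞), Measurable φ →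
      ∫⁻ x, φ (spFreq x) * coneJap b (z - x) ≤
        C * ∫⁻ r in Ioi (0 : ℝ), ENNReal.ofReal r * φ r := by
  obtain ⟨C, hC⟩ := exists_lintegral_jap_abs_sub_le hb
  refine ⟨(2 * π).toNNReal * C, fun z φ hφ => ?_⟩
  rw [lintegral_spaceTime_polar _ (by fun_prop), ← lintegral_const_mul _ (by fun_prop)]
  refine setLIntegral_mono' measurableSet_Ioi fun r (hr : 0 < r) => ?_
  rw [mul_left_comm]
  gcongr
  calc _ ≤ ∫⁻ θ in Ioo (-π) π, φ r * C := by
        refine lintegral_mono fun θ => ?_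
        calc _ = ∫⁻ τ : ℝ, φ r * jap b (|τ - z 0| - spFreq (z - polarPoint r 0 θ)) := by
              refine lintegral_congr fun τ => ?_
              rw [spFreq_polarPoint hr.le, coneJap, abs_sub_comm]
              rfl
          _ ≤ φ r * C := by
              rw [lintegral_const_mul _ (by fun_prop)]
              gcongr
              exact hC _ _
    _ = _ := by
        rw [lintegral_const, Measure.restrict_apply_univ, Real.volume_Ioo, sub_neg_eq_add,
          ← two_mul]
        push_cast
        change _ = ENNReal.ofReal (2 * π) * _ * _
        ring

section CauchySchwarz

variable {α : Type*} [MeasurableSpace α] {μ : Measure α}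

lemma lintegral_mul_sq_le (u v : α → ℝ≥0∞) (hu : AEMeasurable u μ) (hv : AEMeasurable v μ) :
    (∫⁻ x, u x * v x ∂μ) ^ 2 ≤ (∫⁻ x, u x ^ 2 ∂μ) * ∫⁻ x, v x ^ 2 ∂μ := by
  have h := ENNReal.lintegral_mul_le_Lp_mul_Lq μ Real.HolderConjugate.two_two hu hv
  simp only [Pi.mul_apply, ENNReal.rpow_ofNat] at h
  calc _ ≤ ((∫⁻ x, u x ^ 2 ∂μ) ^ (1 / 2 : ℝ) * (∫⁻ x, v x ^ 2 ∂μ) ^ (1 / 2 : ℝ)) ^ 2 := by gcongr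
    _ = _ := by
      rw [mul_pow, ← ENNReal.rpow_natCast, ← ENNReal.rpow_natCast, ← ENNReal.rpow_mul,
        ← ENNReal.rpow_mul]
      norm_num

lemma lintegral_mul_sq_le_weighted {u v w w' : α → ℝ≥0∞} (hu : AEMeasurable u μ)
    (hv : AEMeasurable v μ) (hw : AEMeasurable w μ) (hw' : AEMeasurable w' μ)
    (h : ∀ x, w x * w' x = 1) :
    (∫⁻ x, u x * v x ∂μ) ^ 2 ≤ (∫⁻ x, u x ^ 2 * w x ∂μ) * ∫⁻ x, v x ^ 2 * w' x ∂μ := by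
  have key := lintegral_mul_sq_le (fun x => u x * w x ^ (1 / 2 : ℝ))
    (fun x => v x * w' x ^ (1 / 2 : ℝ)) (hu.mul (hw.pow_const _)) (hv.mul (hw'.pow_const _))
  have sq : ∀ t : ℝ≥0∞, (t ^ (1 / 2 : ℝ)) ^ 2 = t := fun t => by
    rw [← ENNReal.rpow_natCast, ← ENNReal.rpow_mul]; norm_num
  simp only [mul_pow, sq] at key
  refine le_trans (le_of_eq ?_) key
  congr 1
  refine lintegral_congr fun x => ?_
  rw [mul_mul_mul_comm, ← ENNReal.mul_rpow_of_nonneg _ _ (by norm_num), h, ENNReal.one_rpow,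
    mul_one]

end CauchySchwarz

section Trilinear

variable {f g h wF wG wH iF iG iH : SpaceTime → ℝ≥0∞}
  {S : SpaceTime × SpaceTime → ℝ≥0∞} {C : ℝ≥0}

lemma trilinear_fixed_left (hf : Measurable f) (hg : Measurable g) (hh : Measurable h)
    (hwF : Measurable wF) (hwG : Measurable wG) (hwH : Measurable wH)
    (hiF : Measurable iF) (hiG : Measurable iG) (hiH : Measurable iH)
    (hS : Measurable S) (hS2 : ∀ p, S p ^ 2 = S p)
    (hF : ∀ x, wF x * iF x = 1) (hG : ∀ x, wG x * iG x = 1) (hH : ∀ x, wH x * iH x = 1)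
    (hC : ∀ x, ∫⁻ y, S (x, y) * (iG y * iH (x + y)) ≤ C * wF x) :
    (∫⁻ x, ∫⁻ y, f x * (g y * h (x + y)) * S (x, y)) ^ 2 ≤
      C * ((∫⁻ x, f x ^ 2 * wF x) * (∫⁻ x, g x ^ 2 * wG x) * ∫⁻ x, h x ^ 2 * wH x) := by
  set B : SpaceTime → ℝ≥0∞ := fun x => ∫⁻ y, (g y * h (x + y)) * S (x, y) with hB
  have hBm : Measurable B := Measurable.lintegral_prod_right'
    (f := fun p : SpaceTime × SpaceTime => (g p.2 * h (p.1 + p.2)) * S (p.1, p.2)) (by fun_prop)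
  have e1 : ∫⁻ x, ∫⁻ y, f x * (g y * h (x + y)) * S (x, y) = ∫⁻ x, f x * B x := by
    refine lintegral_congr fun x => ?_
    rw [hB, ← lintegral_const_mul _ (by fun_prop)]
    simp only [mul_assoc]
  have e2 : ∀ x, B x ^ 2 * iF x ≤ C * ∫⁻ y, g y ^ 2 * wG y * (h (x + y) ^ 2 * wH (x + y)) := by
    intro x
    have h1 := lintegral_mul_sq_le_weighted (μ := volume) (u := fun y => g y * h (x + y))
      (v := fun y => S (x, y)) (w := fun y => wG y * wH (x + y))
      (w' := fun y => iG y * iH (x + y)) (by fun_prop) (by fun_prop) (by fun_prop) (by fun_prop)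
      (fun y => by rw [mul_mul_mul_comm, hG, hH, one_mul])
    simp only [hS2] at h1
    calc B x ^ 2 * iF x ≤ (∫⁻ y, (g y * h (x + y)) ^ 2 * (wG y * wH (x + y))) * (C * wF x) *
          iF x := by gcongr; exact h1.trans (mul_le_mul_right (hC x) _)
      _ = C * (∫⁻ y, (g y * h (x + y)) ^ 2 * (wG y * wH (x + y))) * (wF x * iF x) := by ring
      _ = _ := by
        rw [hF, mul_one]
        congr 1
        refine lintegral_congr fun y => by ring
  rw [e1]
  calc (∫⁻ x, f x * B x) ^ 2 ≤ (∫⁻ x, f x ^ 2 * wF x) * ∫⁻ x, B x ^ 2 * iF x :=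
        lintegral_mul_sq_le_weighted hf.aemeasurable hBm.aemeasurable hwF.aemeasurable
          hiF.aemeasurable hF
    _ ≤ (∫⁻ x, f x ^ 2 * wF x) *
          ∫⁻ x, C * ∫⁻ y, g y ^ 2 * wG y * (h (x + y) ^ 2 * wH (x + y)) := by
        exact mul_le_mul_right (lintegral_mono e2) _
    _ = (∫⁻ x, f x ^ 2 * wF x) *
          (C * ((∫⁻ x, g x ^ 2 * wG x) * ∫⁻ x, h x ^ 2 * wH x)) := by
        congr 1
        rw [lintegral_const_mul' _ _ ENNReal.coe_ne_top, lintegral_lintegral_swap (by fun_prop)]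
        congr 1
        rw [← lintegral_mul_const _ (by fun_prop)]
        refine lintegral_congr fun y => ?_
        rw [lintegral_const_mul _ (by fun_prop),
          lintegral_add_right_eq_self (fun x => h x ^ 2 * wH x) y]
    _ = _ := by ring

lemma trilinear_fixed_sum (hf : Measurable f) (hg : Measurable g) (hh : Measurable h)
    (hwF : Measurable wF) (hwG : Measurable wG) (hwH : Measurable wH)
    (hiF : Measurable iF) (hiG : Measurable iG) (hiH : Measurable iH)
    (hS : Measurable S) (hS2 : ∀ p, S p ^ 2 = S p)
    (hF : ∀ x, wF x * iF x = 1) (hG : ∀ x, wG x * iG x = 1) (hH : ∀ x, wH x * iH x = 1)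
    (hC : ∀ z, ∫⁻ x, S (x, z - x) * (iF x * iG (z - x)) ≤ C * wH z) :
    (∫⁻ x, ∫⁻ y, f x * (g y * h (x + y)) * S (x, y)) ^ 2 ≤
      C * ((∫⁻ x, f x ^ 2 * wF x) * (∫⁻ x, g x ^ 2 * wG x) * ∫⁻ x, h x ^ 2 * wH x) := by
  have hsub : ∀ φ : SpaceTime → ℝ≥0∞, ∀ x, ∫⁻ z, φ (z - x) = ∫⁻ y, φ y :=
    fun φ x => lintegral_sub_right_eq_self φ x
  set B : SpaceTime → ℝ≥0∞ := fun z => ∫⁻ x, (f x * g (z - x)) * S (x, z - x) with hB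
  have hBm : Measurable B := Measurable.lintegral_prod_right'
    (f := fun p : SpaceTime × SpaceTime => (f p.2 * g (p.1 - p.2)) * S (p.2, p.1 - p.2))
    (by fun_prop)
  have e1 : ∫⁻ x, ∫⁻ y, f x * (g y * h (x + y)) * S (x, y) = ∫⁻ z, h z * B z := by
    calc _ = ∫⁻ x, ∫⁻ z, h z * ((f x * g (z - x)) * S (x, z - x)) := by
          refine lintegral_congr fun x => ?_
          rw [← hsub _ x]
          refine lintegral_congr fun z => ?_
          rw [add_sub_cancel]
          ring
      _ = _ := by
          rw [lintegral_lintegral_swap (by fun_prop)]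
          refine lintegral_congr fun z => ?_
          rw [hB, lintegral_const_mul _ (by fun_prop)]
  have e2 : ∀ z, B z ^ 2 * iH z ≤ C * ∫⁻ x, f x ^ 2 * wF x * (g (z - x) ^ 2 * wG (z - x)) := by
    intro z
    have h1 := lintegral_mul_sq_le_weighted (μ := volume) (u := fun x => f x * g (z - x))
      (v := fun x => S (x, z - x)) (w := fun x => wF x * wG (z - x))
      (w' := fun x => iF x * iG (z - x)) (by fun_prop) (by fun_prop) (by fun_prop) (by fun_prop)
      (fun y => by rw [mul_mul_mul_comm, hF, hG, one_mul])
    simp only [hS2] at h1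
    calc B z ^ 2 * iH z ≤ (∫⁻ x, (f x * g (z - x)) ^ 2 * (wF x * wG (z - x))) * (C * wH z) *
          iH z := by gcongr; exact h1.trans (mul_le_mul_right (hC z) _)
      _ = C * (∫⁻ x, (f x * g (z - x)) ^ 2 * (wF x * wG (z - x))) * (wH z * iH z) := by ring
      _ = _ := by
        rw [hH, mul_one]
        congr 1
        refine lintegral_congr fun y => by ring
  rw [e1]
  calc (∫⁻ x, h x * B x) ^ 2 ≤ (∫⁻ x, h x ^ 2 * wH x) * ∫⁻ x, B x ^ 2 * iH x :=
        lintegral_mul_sq_le_weighted hh.aemeasurable hBm.aemeasurable hwH.aemeasurable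
          hiH.aemeasurable hH
    _ ≤ (∫⁻ x, h x ^ 2 * wH x) *
          ∫⁻ z, C * ∫⁻ x, f x ^ 2 * wF x * (g (z - x) ^ 2 * wG (z - x)) := by
        exact mul_le_mul_right (lintegral_mono e2) _
    _ = (∫⁻ x, h x ^ 2 * wH x) *
          (C * ((∫⁻ x, f x ^ 2 * wF x) * ∫⁻ x, g x ^ 2 * wG x)) := by
        congr 1
        rw [lintegral_const_mul' _ _ ENNReal.coe_ne_top, lintegral_lintegral_swap (by fun_prop)]
        congr 1
        rw [← lintegral_mul_const _ (by fun_prop)]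
        refine lintegral_congr fun y => ?_
        rw [lintegral_const_mul _ (by fun_prop), hsub (fun x => g x ^ 2 * wG x) y]
    _ = _ := by ring

lemma jap_mul_jap (p q x : ℝ) : jap p x * jap q x = jap (p + q) x := by
  unfold jap
  rw [← ENNReal.ofReal_mul (by positivity), ← Real.rpow_add (by positivity), neg_add]

lemma jap_mul_jap_neg (p x : ℝ) : jap p x * jap (-p) x = 1 := by
  rw [jap_mul_jap]; simp [jap]

lemma trilinear_radial {p : ℝ} {D : ℝ≥0}
    (hf : Measurable f) (hg : Measurable g) (hh : Measurable h)
    (hwF : Measurable wF) (hwG : Measurable wG) (hwH : Measurable wH)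
    (hiG : Measurable iG) (hiH : Measurable iH)
    (hS : Measurable S) (hS2 : ∀ p, S p ^ 2 = S p)
    (hG : ∀ x, wG x * iG x = 1) (hH : ∀ x, wH x * iH x = 1)
    (hp : ∀ c, ∫⁻ r, jap p (r - c) ≤ D)
    (hC : ∀ x, ∀ φ : ℝ → ℝ≥0∞, Measurable φ →
      ∫⁻ y, φ (spFreq y) * (S (x, y) * (iG y * iH (x + y)) *
        jap (-p) (spFreq y - spFreq (x + y))) ≤ C * wF x * ∫⁻ r, φ r) :
    (∫⁻ x, ∫⁻ y, f x * (g y * h (x + y)) * S (x, y)) ^ 2 ≤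
      (C * D : ℝ≥0) *
        ((∫⁻ x, f x ^ 2 * wF x) * (∫⁻ x, g x ^ 2 * wG x) * ∫⁻ x, h x ^ 2 * wH x) := by
  set A : ℝ → ℝ≥0∞ := fun r => ∫⁻ z, h z ^ 2 * wH z * jap p (r - spFreq z) with hA
  have hAm : Measurable A := Measurable.lintegral_prod_right'
    (f := fun q : ℝ × SpaceTime => h q.2 ^ 2 * wH q.2 * jap p (q.1 - spFreq q.2)) (by fun_prop)
  have hAint : ∫⁻ r, A r ≤ D * ∫⁻ z, h z ^ 2 * wH z := by
    rw [hA, lintegral_lintegral_swap (by fun_prop), ← lintegral_const_mul _ (by fun_prop)]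
    refine lintegral_mono fun z => ?_
    rw [lintegral_const_mul _ (by fun_prop), mul_comm]
    exact mul_le_mul_left (hp _) _
  set B : SpaceTime → ℝ≥0∞ := fun y => ∫⁻ x, h (x + y) * (f x * S (x, y)) with hB
  have hBm : Measurable B := Measurable.lintegral_prod_right'
    (f := fun p : SpaceTime × SpaceTime => h (p.2 + p.1) * (f p.2 * S (p.2, p.1))) (by fun_prop)
  have e1 : ∫⁻ x, ∫⁻ y, f x * (g y * h (x + y)) * S (x, y) = ∫⁻ y, g y * B y := by
    rw [lintegral_lintegral_swap (by fun_prop)]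
    refine lintegral_congr fun y => ?_
    rw [hB, ← lintegral_const_mul _ (by fun_prop)]
    refine lintegral_congr fun x => ?_
    ring
  have e2 : ∀ y, B y ^ 2 * iG y ≤ ∫⁻ x, f x ^ 2 * (A (spFreq y) * (S (x, y) *
      (iG y * iH (x + y)) * jap (-p) (spFreq y - spFreq (x + y)))) := by
    intro y
    have h1 := lintegral_mul_sq_le_weighted (μ := volume) (u := fun x => h (x + y))
      (v := fun x => f x * S (x, y))
      (w := fun x => wH (x + y) * jap p (spFreq y - spFreq (x + y)))
      (w' := fun x => iH (x + y) * jap (-p) (spFreq y - spFreq (x + y)))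
      (by fun_prop) (by fun_prop) (by fun_prop) (by fun_prop)
      (fun x => by rw [mul_mul_mul_comm, hH, jap_mul_jap_neg, one_mul])
    have h2 : ∫⁻ x, h (x + y) ^ 2 * (wH (x + y) * jap p (spFreq y - spFreq (x + y))) =
        A (spFreq y) := by
      simp only [← mul_assoc]
      exact lintegral_add_right_eq_self (fun z => h z ^ 2 * wH z * jap p (spFreq y - spFreq z)) y
    rw [h2] at h1
    calc B y ^ 2 * iG y ≤ _ := mul_le_mul_left h1 _
      _ = _ := by
        rw [← lintegral_const_mul _ (by fun_prop), ← lintegral_mul_const _ (by fun_prop)]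
        refine lintegral_congr fun x => ?_
        rw [mul_pow, hS2]
        ring
  rw [e1]
  calc (∫⁻ y, g y * B y) ^ 2 ≤ (∫⁻ y, g y ^ 2 * wG y) * ∫⁻ y, B y ^ 2 * iG y :=
        lintegral_mul_sq_le_weighted hg.aemeasurable hBm.aemeasurable hwG.aemeasurable
          hiG.aemeasurable hG
    _ ≤ (∫⁻ y, g y ^ 2 * wG y) * ∫⁻ y, ∫⁻ x, f x ^ 2 * (A (spFreq y) * (S (x, y) *
          (iG y * iH (x + y)) * jap (-p) (spFreq y - spFreq (x + y)))) := by
        exact mul_le_mul_right (lintegral_mono e2) _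
    _ ≤ (∫⁻ y, g y ^ 2 * wG y) *
          ∫⁻ x, (C * D * ∫⁻ z, h z ^ 2 * wH z) * (f x ^ 2 * wF x) := by
        refine mul_le_mul_right ?_ _
        rw [lintegral_lintegral_swap (by fun_prop)]
        refine lintegral_mono fun x => ?_
        rw [lintegral_const_mul _ (by fun_prop)]
        calc _ ≤ f x ^ 2 * (C * wF x * (D * ∫⁻ z, h z ^ 2 * wH z)) := by
              gcongr
              exact (hC x A hAm).trans (by gcongr)
          _ = _ := by ring
    _ = (∫⁻ y, g y ^ 2 * wG y) *
          ((C * D * ∫⁻ z, h z ^ 2 * wH z) * ∫⁻ x, f x ^ 2 * wF x) := by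
        rw [lintegral_const_mul _ (by fun_prop)]
    _ = _ := by push_cast; ring

end Trilinear

lemma spFreq_eq_norm (ζ : SpaceTime) : spFreq ζ = ‖(⟨ζ 1, ζ 2⟩ : ℂ)‖ := by
  rw [Complex.norm_def, Complex.normSq_mk, spFreq, sq, sq]

lemma spFreq_nonneg (ζ : SpaceTime) : 0 ≤ spFreq ζ := Real.sqrt_nonneg _

lemma spFreq_neg (x : SpaceTime) : spFreq (-x) = spFreq x := by simp [spFreq]

lemma spFreq_add_le (x y : SpaceTime) : spFreq (x + y) ≤ spFreq x + spFreq y := by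
  simp only [spFreq_eq_norm]
  exact norm_add_le (⟨x 1, x 2⟩ : ℂ) ⟨y 1, y 2⟩

lemma spFreq_right_le (x y : SpaceTime) : spFreq y ≤ spFreq (x + y) + spFreq x := by
  have := spFreq_add_le (x + y) (-x)
  rwa [spFreq_neg, add_neg_cancel_comm] at this

lemma jap_of_nonneg (p : ℝ) {x : ℝ} (hx : 0 ≤ x) : jap p x = ENNReal.ofReal ((1 + x) ^ (-p)) := by
  rw [jap, abs_of_nonneg hx]

lemma jap_spFreq (p : ℝ) (x : SpaceTime) :
    jap p (spFreq x) = ENNReal.ofReal ((1 + spFreq x) ^ (-p)) :=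
  jap_of_nonneg p (spFreq_nonneg x)

lemma exists_lintegral_jap_Ioi_le {p : ℝ} (hp : 1 < p) :
    ∃ C : ℝ≥0, ∫⁻ r in Ioi (0 : ℝ), jap p r ≤ C := by
  obtain ⟨C, hC⟩ := exists_lintegral_jap_le hp
  refine ⟨C, (setLIntegral_le_lintegral _ _).trans ?_⟩
  simpa using hC 0

lemma ofReal_le_jap {r : ℝ} (hr : 0 ≤ r) : ENNReal.ofReal r ≤ jap (-1) r := by
  rw [jap_of_nonneg _ hr, neg_neg, Real.rpow_one]
  exact ENNReal.ofReal_le_ofReal (by linarith)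

/-- Pairs `(x, y)` for which the sum has frequency at most comparable to that of `x`. -/
def lowSum : Set (SpaceTime × SpaceTime) :=
  {p | 1 + spFreq (p.1 + p.2) ≤ 2 * (1 + spFreq p.1)}

/-- Pairs `(x, y)` for which the sum has much higher frequency than `x`. -/
def highSum : Set (SpaceTime × SpaceTime) :=
  lowSumᶜ ∩ {p | (1 + spFreq p.1) ^ (3 / 2 : ℝ) ≤ 1 + spFreq (p.1 + p.2)}

/-- Pairs `(x, y)` for which the sum has moderately higher frequency than `x`. -/
def midSum : Set (SpaceTime × SpaceTime) :=
  lowSumᶜ ∩ {p | (1 + spFreq p.1) ^ (3 / 2 : ℝ) ≤ 1 + spFreq (p.1 + p.2)}ᶜ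

lemma measurableSet_lowSum : MeasurableSet lowSum :=
  measurableSet_le (by fun_prop) (by fun_prop)

lemma measurableSet_highSum : MeasurableSet highSum :=
  measurableSet_lowSum.compl.inter (measurableSet_le (by fun_prop) (by fun_prop))

lemma measurableSet_midSum : MeasurableSet midSum :=
  measurableSet_lowSum.compl.inter (measurableSet_le (by fun_prop) (by fun_prop)).compl

lemma indicator_sums (p : SpaceTime × SpaceTime) :
    lowSum.indicator (1 : SpaceTime × SpaceTime → ℝ≥0∞) p + highSum.indicator 1 p +
      midSum.indicator 1 p = 1 := by
  unfold highSum midSum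
  by_cases h1 : p ∈ lowSum
  · simp [h1]
  · by_cases h2 : (1 + spFreq p.1) ^ (3 / 2 : ℝ) ≤ 1 + spFreq (p.1 + p.2) <;>
      simp [Set.indicator, h1, h2]

lemma indicator_one_sq {α : Type*} (E : Set α) (p : α) :
    E.indicator (1 : α → ℝ≥0∞) p ^ 2 = E.indicator 1 p := by
  by_cases h : p ∈ E <;> simp [h]

lemma exists_lintegral_lowSum_le {a β b k : ℝ} (ha : 0 ≤ a) (hβ : 3 / 4 < β) (hb : 1 < b)
    (hk : 1 / 2 < k) : ∃ C : ℝ≥0, ∀ x,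
      ∫⁻ y, lowSum.indicator 1 (x, y) * (jap (2 * β) (spFreq y) * coneJap b y *
        (jap (-(2 * a)) (spFreq (x + y)) * coneJap k (x + y))) ≤
          C * jap (-(2 * a)) (spFreq x) := by
  obtain ⟨C₁, hC₁⟩ := exists_lintegral_coneJap_mul_le hb hk
  obtain ⟨C₂, hC₂⟩ := exists_lintegral_jap_Ioi_le (p := 2 * β - 1 / 2) (by linarith)
  refine ⟨((2 : ℝ) ^ (2 * a)).toNNReal * (C₁ * (2 * C₂)), fun x => ?_⟩
  set φ : ℝ → ℝ≥0∞ := fun r => jap (2 * β) r *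
    {r | 1 + r ≤ 3 * (1 + spFreq x)}.indicator 1 r with hφ
  have hφm : Measurable φ := (measurable_jap _).mul
    (measurable_one.indicator (measurableSet_le (by fun_prop) (by fun_prop)))
  have hx := spFreq_nonneg x
  have h1 : ∀ y, lowSum.indicator 1 (x, y) * (jap (2 * β) (spFreq y) * coneJap b y *
        (jap (-(2 * a)) (spFreq (x + y)) * coneJap k (x + y))) ≤
      ENNReal.ofReal (2 ^ (2 * a)) * jap (-(2 * a)) (spFreq x) *
        (φ (spFreq y) * (coneJap b y * coneJap k (x + y))) := by
    intro y
    by_cases h : (x, y) ∈ lowSum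
    · have h' : 1 + spFreq (x + y) ≤ 2 * (1 + spFreq x) := h
      have h2 : spFreq y ∈ {r | 1 + r ≤ 3 * (1 + spFreq x)} := by
        have := spFreq_right_le x y
        simp only [mem_ofPred_eq]; linarith
      have h3 : jap (-(2 * a)) (spFreq (x + y)) ≤
          ENNReal.ofReal (2 ^ (2 * a)) * jap (-(2 * a)) (spFreq x) := by
        rw [jap_spFreq, jap_spFreq, ← ENNReal.ofReal_mul (by positivity), neg_neg,
          ← Real.mul_rpow (by norm_num) (by positivity)]
        have := spFreq_nonneg (x + y)
        gcongr
      rw [indicator_of_mem h, hφ]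
      simp only [indicator_of_mem h2, Pi.one_apply, one_mul, mul_one]
      calc _ ≤ jap (2 * β) (spFreq y) * coneJap b y * (ENNReal.ofReal (2 ^ (2 * a)) *
            jap (-(2 * a)) (spFreq x) * coneJap k (x + y)) := by gcongr
        _ = _ := by ring
    · rw [indicator_of_notMem h, zero_mul]; exact zero_le
  have h2 : ∀ r ∈ Ioi (0 : ℝ), ENNReal.ofReal r * (φ r * jap (1 / 2) (min (spFreq x) r)) ≤
      2 * jap (2 * β - 1 / 2) r := by
    intro r hr
    have hr : 0 < r := hr
    by_cases h : r ∈ {r | 1 + r ≤ 3 * (1 + spFreq x)}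
    · have h' : 1 + r ≤ 3 * (1 + spFreq x) := h
      have h3 : jap (1 / 2) (min (spFreq x) r) ≤ 2 * jap (1 / 2) r := by
        have e : (2 : ℝ≥0∞) = ENNReal.ofReal (4 ^ (1 / 2 : ℝ)) := by
          rw [← Real.sqrt_eq_rpow, show (4 : ℝ) = 2 ^ 2 by norm_num, Real.sqrt_sq (by norm_num)]
          simp
        rw [jap_of_nonneg _ (by positivity), jap_of_nonneg _ hr.le, e,
          ← ENNReal.ofReal_mul (by positivity)]
        refine ENNReal.ofReal_le_ofReal ?_
        have e2 : (4 : ℝ) ^ (1 / 2 : ℝ) = (1 / 4 : ℝ) ^ (-(1 / 2) : ℝ) := by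
          rw [one_div (4 : ℝ), Real.inv_rpow (by norm_num), Real.rpow_neg (by norm_num), inv_inv]
        rw [e2, ← Real.mul_rpow (by norm_num) (by positivity)]
        refine Real.rpow_le_rpow_of_nonpos (by positivity) ?_ (by norm_num)
        rcases min_cases (spFreq x) r with ⟨h5, -⟩ | ⟨h5, -⟩ <;> rw [h5] <;> linarith
      simp only [hφ, indicator_of_mem h, Pi.one_apply, mul_one]
      calc _ ≤ jap (-1) r * (jap (2 * β) r * (2 * jap (1 / 2) r)) := by
            gcongr
            exact ofReal_le_jap hr.le
        _ = 2 * (jap (-1) r * jap (2 * β) r * jap (1 / 2) r) := by ring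
        _ = _ := by rw [jap_mul_jap, jap_mul_jap]; ring_nf
    · simp [hφ, indicator_of_notMem h]
  calc _ ≤ _ := lintegral_mono h1
    _ = ENNReal.ofReal (2 ^ (2 * a)) * jap (-(2 * a)) (spFreq x) *
        ∫⁻ y, φ (spFreq y) * (coneJap b y * coneJap k (x + y)) := by
      rw [lintegral_const_mul _ (by fun_prop)]
    _ ≤ ENNReal.ofReal (2 ^ (2 * a)) * jap (-(2 * a)) (spFreq x) * (C₁ * (2 * C₂)) := by
      gcongr
      refine (hC₁ x φ hφm).trans ?_
      gcongr
      refine (setLIntegral_mono' measurableSet_Ioi h2).trans ?_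
      rw [lintegral_const_mul _ (by fun_prop)]
      gcongr
    _ = _ := by push_cast; rw [ENNReal.ofReal]; ring

lemma rpow_highSum_le {a β X₀ X₁ X₂ : ℝ} (hβ : 0 ≤ β) (haβ : a ≤ β) (h0 : 1 ≤ X₀)
    (h1 : 1 ≤ X₁) (h2 : X₀ / 2 ≤ X₂) (h : X₁ ^ (3 / 2 : ℝ) ≤ X₀) :
    X₁ ^ (-(2 * a)) * X₂ ^ (-(2 * β)) ≤
      2 ^ (2 * β) * X₀ ^ (-(2 * a)) * X₁ ^ (-(3 * β - a)) := by
  have p1 : 0 < X₁ := by linarith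
  have p0 : 0 < X₀ := by linarith
  calc X₁ ^ (-(2 * a)) * X₂ ^ (-(2 * β))
      ≤ X₁ ^ (-(2 * a)) * (X₀ / 2) ^ (-(2 * β)) := by
        gcongr ?_ * ?_
        exact Real.rpow_le_rpow_of_nonpos (by positivity) h2 (by linarith)
    _ = 2 ^ (2 * β) * X₀ ^ (-(2 * a)) * (X₁ ^ (-(2 * a)) * X₀ ^ (-(2 * (β - a)))) := by
        rw [Real.div_rpow (by positivity) (by norm_num), Real.rpow_neg (by norm_num : (0 : ℝ) ≤ 2),
          show -(2 * β) = -(2 * a) + -(2 * (β - a)) by ring, Real.rpow_add p0, div_inv_eq_mul]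
        ring
    _ ≤ 2 ^ (2 * β) * X₀ ^ (-(2 * a)) *
        (X₁ ^ (-(2 * a)) * (X₁ ^ (3 / 2 : ℝ)) ^ (-(2 * (β - a)))) := by
        gcongr ?_ * (?_ * ?_)
        exact Real.rpow_le_rpow_of_nonpos (by positivity) h (by linarith)
    _ = _ := by
        rw [← Real.rpow_mul p1.le, ← Real.rpow_add p1]
        ring_nf

lemma exists_lintegral_highSum_le {a β b k : ℝ} (hβ : 0 ≤ β) (haβ : a ≤ β)
    (h3 : 2 < 3 * β - a) (hb : 1 < b) (hk : 0 ≤ k) : ∃ C : ℝ≥0, ∀ z,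
      ∫⁻ x, highSum.indicator 1 (x, z - x) * (jap (2 * a) (spFreq x) *
        (jap (2 * β) (spFreq (z - x)) * coneJap b (z - x))) ≤
          C * (jap (2 * a) (spFreq z) * coneJap (-k) z) := by
  obtain ⟨C₁, hC₁⟩ := exists_lintegral_coneJap_sub_le hb
  obtain ⟨C₂, hC₂⟩ := exists_lintegral_jap_Ioi_le (p := 3 * β - a - 1) (by linarith)
  refine ⟨((2 : ℝ) ^ (2 * β)).toNNReal * (C₁ * C₂), fun z => ?_⟩
  have h1 : ∀ x, highSum.indicator 1 (x, z - x) * (jap (2 * a) (spFreq x) *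
        (jap (2 * β) (spFreq (z - x)) * coneJap b (z - x))) ≤
      ENNReal.ofReal (2 ^ (2 * β)) * jap (2 * a) (spFreq z) *
        (jap (3 * β - a) (spFreq x) * coneJap b (z - x)) := by
    intro x
    by_cases h : (x, z - x) ∈ highSum
    · have h' : ¬ (1 + spFreq (x + (z - x)) ≤ 2 * (1 + spFreq x)) ∧
          (1 + spFreq x) ^ (3 / 2 : ℝ) ≤ 1 + spFreq (x + (z - x)) := h
      rw [indicator_of_mem h, Pi.one_apply, one_mul, ← mul_assoc, ← mul_assoc]
      have h4 := spFreq_add_le x (z - x)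
      rw [add_sub_cancel] at h' h4
      gcongr ?_ * _
      have := spFreq_nonneg x
      have := spFreq_nonneg z
      have := spFreq_nonneg (z - x)
      rw [jap_spFreq, jap_spFreq, jap_spFreq, jap_spFreq, ← ENNReal.ofReal_mul (by positivity),
        ← ENNReal.ofReal_mul (by positivity), ← ENNReal.ofReal_mul (by positivity)]
      exact ENNReal.ofReal_le_ofReal
        (rpow_highSum_le hβ haβ (by linarith) (by linarith) (by linarith) h'.2)
    · rw [indicator_of_notMem h, zero_mul]; exact zero_le
  calc _ ≤ _ := lintegral_mono h1
    _ = ENNReal.ofReal (2 ^ (2 * β)) * jap (2 * a) (spFreq z) *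
        ∫⁻ x, jap (3 * β - a) (spFreq x) * coneJap b (z - x) := by
      rw [lintegral_const_mul _ (by fun_prop)]
    _ ≤ ENNReal.ofReal (2 ^ (2 * β)) * (jap (2 * a) (spFreq z) * coneJap (-k) z) * (C₁ * C₂) := by
      gcongr
      · refine le_mul_of_one_le_right' ?_
        rw [coneJap, jap, neg_neg]
        exact ENNReal.one_le_ofReal.2 (Real.one_le_rpow (by simp) hk)
      refine (hC₁ z _ (by fun_prop)).trans ?_
      gcongr
      refine (setLIntegral_mono' measurableSet_Ioi fun r hr => ?_).trans hC₂
      calc _ ≤ jap (-1) r * jap (3 * β - a) r := by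
            gcongr
            exact ofReal_le_jap (le_of_lt hr)
        _ = _ := by rw [jap_mul_jap]; ring_nf
    _ = _ := by push_cast; rw [ENNReal.ofReal]; ring

lemma rpow_midSum_le {a β p X R : ℝ} (hX : 1 ≤ X) (h1 : X ≤ R) (h2 : R ≤ 2 * X ^ (3 / 2 : ℝ))
    (hp : p ≤ 3 * β - a - 1) (hp' : p ≤ 2 * β - 1 / 2) :
    X ^ p * (R ^ (1 + 2 * a - 2 * β) * X ^ (-(1 / 2) : ℝ)) ≤
      2 ^ |1 + 2 * a - 2 * β| * X ^ (2 * a) := by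
  have p1 : 0 < X := by linarith
  have p2 : 0 < R := by linarith
  rcases le_or_gt 0 (1 + 2 * a - 2 * β) with he | he
  · calc _ ≤ X ^ p * ((2 * X ^ (3 / 2 : ℝ)) ^ (1 + 2 * a - 2 * β) * X ^ (-(1 / 2) : ℝ)) := by gcongr
      _ = 2 ^ (1 + 2 * a - 2 * β) *
          X ^ (p + 3 / 2 * (1 + 2 * a - 2 * β) + -(1 / 2) : ℝ) := by
        rw [Real.mul_rpow (by norm_num) (by positivity), ← Real.rpow_mul p1.le,
          Real.rpow_add p1, Real.rpow_add p1]
        ring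
      _ ≤ _ := by
        rw [abs_of_nonneg he]
        gcongr
        linarith
  · calc _ ≤ X ^ p * (X ^ (1 + 2 * a - 2 * β) * X ^ (-(1 / 2) : ℝ)) := by
          gcongr ?_ * (?_ * ?_)
          exact Real.rpow_le_rpow_of_nonpos p1 h1 he.le
      _ = 1 * X ^ (p + (1 + 2 * a - 2 * β) + -(1 / 2) : ℝ) := by
        rw [Real.rpow_add p1, Real.rpow_add p1]
        ring
      _ ≤ _ := by
        gcongr
        · exact Real.one_le_rpow (by norm_num) (abs_nonneg _)
        · linarith

lemma exists_lintegral_midSum_le {a β b k p : ℝ} (ha : 0 ≤ a) (hb : 1 < b) (hk : 1 / 2 < k)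
    (hp0 : 0 ≤ p) (hp : p ≤ 3 * β - a - 1) (hp' : p ≤ 2 * β - 1 / 2) :
    ∃ C : ℝ≥0, ∀ x, ∀ φ : ℝ → ℝ≥0∞, Measurable φ →
      ∫⁻ y, φ (spFreq y) * (midSum.indicator 1 (x, y) *
        (jap (2 * β) (spFreq y) * coneJap b y *
          (jap (-(2 * a)) (spFreq (x + y)) * coneJap k (x + y))) *
        jap (-p) (spFreq y - spFreq (x + y))) ≤
          C * jap (-(2 * a)) (spFreq x) * ∫⁻ r, φ r := by
  obtain ⟨C₁, hC₁⟩ := exists_lintegral_coneJap_mul_le hb hk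
  refine ⟨((2 : ℝ) ^ (2 * a)).toNNReal * C₁ * ((2 : ℝ) ^ |1 + 2 * a - 2 * β|).toNNReal,
    fun x φ hφ => ?_⟩
  set E : Set ℝ := {r | 1 + spFreq x ≤ 1 + r} ∩ {r | 1 + r ≤ 2 * (1 + spFreq x) ^ (3 / 2 : ℝ)}
  have hE : MeasurableSet E := (measurableSet_le (by fun_prop) (by fun_prop)).inter
    (measurableSet_le (by fun_prop) (by fun_prop))
  set ψ : ℝ → ℝ≥0∞ := fun r => φ r * (jap (2 * β - 2 * a) r * E.indicator 1 r) with hψ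
  have hψm : Measurable ψ := hφ.mul ((measurable_jap _).mul (measurable_one.indicator hE))
  have hx := spFreq_nonneg x
  have h1 : ∀ y, φ (spFreq y) * (midSum.indicator 1 (x, y) *
        (jap (2 * β) (spFreq y) * coneJap b y *
          (jap (-(2 * a)) (spFreq (x + y)) * coneJap k (x + y))) *
        jap (-p) (spFreq y - spFreq (x + y))) ≤
      ENNReal.ofReal (2 ^ (2 * a)) * jap (-p) (spFreq x) *
        (ψ (spFreq y) * (coneJap b y * coneJap k (x + y))) := by
    intro y
    by_cases h : (x, y) ∈ midSum
    · have h' : ¬ (1 + spFreq (x + y) ≤ 2 * (1 + spFreq x)) ∧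
          ¬ ((1 + spFreq x) ^ (3 / 2 : ℝ) ≤ 1 + spFreq (x + y)) := h
      have hy := spFreq_nonneg y
      have hxy := spFreq_nonneg (x + y)
      have t1 := spFreq_add_le x y
      have t2 := spFreq_right_le x y
      obtain ⟨h4, h5⟩ := h'
      have h2 : spFreq y ∈ E := by
        refine ⟨?_, ?_⟩ <;> simp only [mem_ofPred_eq] <;> linarith
      have h3 : jap (-(2 * a)) (spFreq (x + y)) ≤
          ENNReal.ofReal (2 ^ (2 * a)) * jap (-(2 * a)) (spFreq y) := by
        rw [jap_spFreq, jap_spFreq, ← ENNReal.ofReal_mul (by positivity), neg_neg,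
          ← Real.mul_rpow (by norm_num) (by positivity)]
        gcongr
        linarith
      have h6 : jap (-p) (spFreq y - spFreq (x + y)) ≤ jap (-p) (spFreq x) := by
        rw [jap_spFreq, jap, neg_neg]
        gcongr
        rw [abs_le]
        constructor <;> linarith
      rw [indicator_of_mem h, hψ]
      simp only [indicator_of_mem h2, Pi.one_apply, one_mul, mul_one]
      calc _ ≤ φ (spFreq y) * (jap (2 * β) (spFreq y) * coneJap b y *
            (ENNReal.ofReal (2 ^ (2 * a)) * jap (-(2 * a)) (spFreq y) * coneJap k (x + y)) * jap (-p) (spFreq x)) := by gcongr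
        _ = ENNReal.ofReal (2 ^ (2 * a)) * jap (-p) (spFreq x) * (φ (spFreq y) *
            (jap (2 * β) (spFreq y) * jap (-(2 * a)) (spFreq y)) *
              (coneJap b y * coneJap k (x + y))) := by ring
        _ = _ := by rw [jap_mul_jap, ← sub_eq_add_neg]
    · rw [indicator_of_notMem h, zero_mul, zero_mul, mul_zero]; exact zero_le
  have h2 : ∀ r ∈ Ioi (0 : ℝ), jap (-p) (spFreq x) *
      (ENNReal.ofReal r * (ψ r * jap (1 / 2) (min (spFreq x) r))) ≤
      ENNReal.ofReal (2 ^ |1 + 2 * a - 2 * β|) * jap (-(2 * a)) (spFreq x) * φ r := by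
    intro r hr
    have hr : 0 < r := hr
    by_cases h : r ∈ E
    · have h' : 1 + spFreq x ≤ 1 + r := h.1
      have h'' : 1 + r ≤ 2 * (1 + spFreq x) ^ (3 / 2 : ℝ) := h.2
      simp only [hψ, indicator_of_mem h, Pi.one_apply, mul_one]
      rw [min_eq_left (by linarith)]
      calc _ ≤ jap (-p) (spFreq x) *
            (jap (-1) r * (φ r * jap (2 * β - 2 * a) r * jap (1 / 2) (spFreq x))) := by
            gcongr
            exact ofReal_le_jap hr.le
        _ = jap (-p) (spFreq x) *
            ((jap (-1) r * jap (2 * β - 2 * a) r) * jap (1 / 2) (spFreq x)) * φ r := by ring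
        _ ≤ _ := by
          gcongr ?_ * _
          rw [jap_mul_jap, jap_spFreq, jap_spFreq, jap_spFreq, jap_of_nonneg _ hr.le,
            ← ENNReal.ofReal_mul (by positivity), ← ENNReal.ofReal_mul (by positivity),
            ← ENNReal.ofReal_mul (by positivity)]
          refine ENNReal.ofReal_le_ofReal ?_
          have := rpow_midSum_le (a := a) (β := β) (p := p) (by linarith) h' h'' hp hp'
          rw [neg_neg, neg_neg, show -(-1 + (2 * β - 2 * a)) = 1 + 2 * a - 2 * β by ring]
          exact this
    · simp [hψ, indicator_of_notMem h]
  calc _ ≤ _ := lintegral_mono h1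
    _ = ENNReal.ofReal (2 ^ (2 * a)) * jap (-p) (spFreq x) *
        ∫⁻ y, ψ (spFreq y) * (coneJap b y * coneJap k (x + y)) := by
      rw [lintegral_const_mul _ (by fun_prop)]
    _ ≤ ENNReal.ofReal (2 ^ (2 * a)) * jap (-p) (spFreq x) * (C₁ *
          ∫⁻ r in Ioi (0 : ℝ), ENNReal.ofReal r * (ψ r * jap (1/2) (min (spFreq x) r))) := by
      gcongr
      exact hC₁ x ψ hψm
    _ = ENNReal.ofReal (2 ^ (2 * a)) * C₁ * ∫⁻ r in Ioi (0 : ℝ), jap (-p) (spFreq x) *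
          (ENNReal.ofReal r * (ψ r * jap (1/2) (min (spFreq x) r))) := by
      rw [lintegral_const_mul _ (by fun_prop)]; ring
    _ ≤ ENNReal.ofReal (2 ^ (2 * a)) * C₁ *
        ((ENNReal.ofReal (2 ^ |1 + 2 * a - 2 * β|) * jap (-(2 * a)) (spFreq x)) * ∫⁻ r, φ r) := by
      gcongr
      refine (setLIntegral_mono' measurableSet_Ioi h2).trans ?_
      rw [lintegral_const_mul _ hφ]
      exact mul_le_mul_right (setLIntegral_le_lintegral _ _) _
    _ = _ := by push_cast; rw [ENNReal.ofReal, ENNReal.ofReal]; ring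

/-- The trilinear form bound dual to the product estimate. -/
theorem exists_trilinear_le {a β b k : ℝ} (ha : 0 ≤ a) (hβ : 3 / 4 < β) (haβ : a ≤ β)
    (h3 : 2 < 3 * β - a) (hb : 1 < b) (hk : 1 / 2 < k) :
    ∃ C : ℝ≥0, ∀ f g h : SpaceTime → ℝ≥0∞, Measurable f → Measurable g → Measurable h →
      (∫⁻ x, ∫⁻ y, f x * (g y * h (x + y))) ^ 2 ≤
        C * ((∫⁻ x, f x ^ 2 * jap (-(2 * a)) (spFreq x)) *
          (∫⁻ x, g x ^ 2 * (jap (-(2 * β)) (spFreq x) * coneJap (-b) x)) *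
          ∫⁻ x, h x ^ 2 * (jap (2 * a) (spFreq x) * coneJap (-k) x)) := by
  set p := min (3 * β - a - 1) (2 * β - 1 / 2) with hp
  have hp1 : 1 < p := lt_min (by linarith) (by linarith)
  obtain ⟨C₁, hC₁⟩ := exists_lintegral_lowSum_le ha hβ hb hk
  obtain ⟨C₂, hC₂⟩ := exists_lintegral_highSum_le (by linarith) haβ h3 hb (k := k) (by linarith)
  obtain ⟨C₃, hC₃⟩ := exists_lintegral_midSum_le (β := β) ha hb hk (p := p) (by linarith)
    (min_le_left _ _) (min_le_right _ _)
  obtain ⟨D, hD⟩ := exists_lintegral_jap_le hp1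
  refine ⟨9 * (C₁ + C₂ + C₃ * D), fun f g h hf hg hh => ?_⟩
  have hF : ∀ x, jap (-(2 * a)) (spFreq x) * jap (2 * a) (spFreq x) = 1 := fun x => by
    rw [mul_comm, jap_mul_jap_neg]
  have hG : ∀ x, jap (-(2 * β)) (spFreq x) * coneJap (-b) x *
      (jap (2 * β) (spFreq x) * coneJap b x) = 1 := fun x => by
    rw [mul_mul_mul_comm, mul_comm, mul_comm (jap _ _), jap_mul_jap_neg, mul_one, coneJap,
      coneJap, mul_comm, jap_mul_jap_neg]
  have hH : ∀ x, jap (2 * a) (spFreq x) * coneJap (-k) x *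
      (jap (-(2 * a)) (spFreq x) * coneJap k x) = 1 := fun x => by
    rw [mul_mul_mul_comm, jap_mul_jap_neg, one_mul, coneJap, coneJap, mul_comm, jap_mul_jap_neg]
  have m1 : Measurable (lowSum.indicator (1 : SpaceTime × SpaceTime → ℝ≥0∞)) :=
    measurable_one.indicator measurableSet_lowSum
  have m2 : Measurable (highSum.indicator (1 : SpaceTime × SpaceTime → ℝ≥0∞)) :=
    measurable_one.indicator measurableSet_highSum
  have m3 : Measurable (midSum.indicator (1 : SpaceTime × SpaceTime → ℝ≥0∞)) :=
    measurable_one.indicator measurableSet_midSum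
  have b1 := trilinear_fixed_left hf hg hh (by fun_prop) (by fun_prop) (by fun_prop)
    (by fun_prop) (by fun_prop) (by fun_prop) m1 (indicator_one_sq _) hF hG hH hC₁
  have b2 := trilinear_fixed_sum hf hg hh (by fun_prop) (by fun_prop) (by fun_prop)
    (by fun_prop) (by fun_prop) (by fun_prop) m2 (indicator_one_sq _) hF hG hH hC₂
  have b3 := trilinear_radial hf hg hh (by fun_prop) (by fun_prop) (by fun_prop)
    (by fun_prop) (by fun_prop) m3 (indicator_one_sq _) hG hH hD hC₃
  set Q := (∫⁻ x, f x ^ 2 * jap (-(2 * a)) (spFreq x)) *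
          (∫⁻ x, g x ^ 2 * (jap (-(2 * β)) (spFreq x) * coneJap (-b) x)) *
          ∫⁻ x, h x ^ 2 * (jap (2 * a) (spFreq x) * coneJap (-k) x)
  have split : ∫⁻ x, ∫⁻ y, f x * (g y * h (x + y)) =
      (∫⁻ x, ∫⁻ y, f x * (g y * h (x + y)) * lowSum.indicator 1 (x, y)) +
      (∫⁻ x, ∫⁻ y, f x * (g y * h (x + y)) * highSum.indicator 1 (x, y)) +
      ∫⁻ x, ∫⁻ y, f x * (g y * h (x + y)) * midSum.indicator 1 (x, y) := by
    have hm : ∀ S : SpaceTime × SpaceTime → ℝ≥0∞, Measurable S →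
        Measurable fun x => ∫⁻ y, f x * (g y * h (x + y)) * S (x, y) := fun S hS =>
      Measurable.lintegral_prod_right' (f := fun q : SpaceTime × SpaceTime =>
        f q.1 * (g q.2 * h (q.1 + q.2)) * S q) (by fun_prop)
    rw [← lintegral_add_left (hm _ m1), ← lintegral_add_right _ (hm _ m3)]
    refine lintegral_congr fun x => ?_
    rw [← lintegral_add_left (by fun_prop), ← lintegral_add_right _ (by fun_prop)]
    refine lintegral_congr fun y => ?_
    rw [← mul_add, ← mul_add, indicator_sums, mul_one]
  rw [split]
  have three : ∀ A B C M : ℝ≥0∞, A ^ 2 ≤ M → B ^ 2 ≤ M → C ^ 2 ≤ M →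
      (A + B + C) ^ 2 ≤ 9 * M := by
    intro A B C M hA hB hC
    have hm : max A (max B C) ^ 2 ≤ M := by
      rcases max_choice A (max B C) with e | e <;> rw [e]
      · exact hA
      · rcases max_choice B C with e | e <;> rw [e] <;> assumption
    calc (A + B + C) ^ 2 ≤ (3 * max A (max B C)) ^ 2 := by
          gcongr
          rw [show (3 : ℝ≥0∞) = 1 + 1 + 1 by norm_num, add_mul, add_mul, one_mul]
          gcongr <;> simp
      _ = 9 * max A (max B C) ^ 2 := by rw [mul_pow]; norm_num
      _ ≤ _ := by gcongr
  refine (three _ _ _ ((C₁ + C₂ + C₃ * D : ℝ≥0) * Q) (b1.trans ?_) (b2.trans ?_)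
    (b3.trans ?_)).trans ?_
  · gcongr
    rw [add_assoc]; exact le_self_add
  · gcongr
    rw [add_right_comm]; exact le_add_self
  · gcongr
    exact le_add_self
  · push_cast
    rw [mul_assoc]

open SchwartzMap in
lemma fourier_mul_apply (u v : SchwartzMap SpaceTime ℂ) (z : SpaceTime) :
    𝓕 (fun x => u x * v x) z = ∫ x, 𝓕 (u : SpaceTime → ℂ) x * 𝓕 (v : SpaceTime → ℂ) (z - x) := by
  let B := ContinuousLinearMap.mul ℂ ℂ
  have h1 : SchwartzMap.convolution B (𝓕⁻ u) (𝓕⁻ v) = 𝓕⁻ (pairing B u v) := by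
    rw [← FourierTransform.fourierInv_fourier_eq (F := SchwartzMap SpaceTime ℂ)
      (SchwartzMap.convolution B (𝓕⁻ u) (𝓕⁻ v)),
      fourier_convolution, FourierTransform.fourier_fourierInv_eq,
      FourierTransform.fourier_fourierInv_eq]
  have h2 := convolution_apply B (𝓕⁻ u) (𝓕⁻ v) (-z)
  rw [h1, convolution_def, fourierInv_coe, Real.fourierInv_eq_fourier_neg, neg_neg] at h2
  refine Eq.trans ?_ (h2.trans ?_)
  · rfl
  · rw [← integral_neg_eq_self]
    refine integral_congr_ae (Filter.Eventually.of_forall fun x => ?_)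
    simp only [B, ContinuousLinearMap.mul_apply', fourierInv_coe, Real.fourierInv_eq_fourier_neg]
    congr 2 <;> abel_nf

/-- The weight of the wave-Sobolev norm. -/
def waveWeight (s b : ℝ) (ζ : SpaceTime) : ℝ :=
  (1 + (spFreq ζ) ^ 2) ^ s * (1 + |(|ζ 0| - spFreq ζ)|) ^ (2 * b)

lemma waveWeight_nonneg (s b : ℝ) (ζ : SpaceTime) : 0 ≤ waveWeight s b ζ := by
  unfold waveWeight; positivity

@[fun_prop]
lemma measurable_waveWeight (s b : ℝ) : Measurable (waveWeight s b) := by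
  unfold waveWeight; fun_prop

lemma rpow_le_rpow_abs {x y : ℝ} (hx : 1 ≤ x) (hxy : x ≤ y) (p : ℝ) : x ^ p ≤ y ^ |p| :=
  (Real.rpow_le_rpow_of_exponent_le hx (le_abs_self p)).trans
    (Real.rpow_le_rpow (by linarith) hxy (abs_nonneg p))

lemma waveWeight_le (s b : ℝ) (ζ : SpaceTime) :
    waveWeight s b ζ ≤ (1 + ‖ζ‖) ^ ⌈2 * |s| + |2 * b|⌉₊ := by
  have hn : ‖ζ‖ ^ 2 = ζ 0 ^ 2 + ζ 1 ^ 2 + ζ 2 ^ 2 := by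
    rw [EuclideanSpace.norm_eq, Real.sq_sqrt (by positivity)]
    simp [Fin.sum_univ_three]
  have hs : spFreq ζ ^ 2 = ζ 1 ^ 2 + ζ 2 ^ 2 := Real.sq_sqrt (by positivity)
  have h0 := spFreq_nonneg ζ
  have hN := norm_nonneg ζ
  have h1 : spFreq ζ ≤ ‖ζ‖ := abs_le_of_sq_le_sq' (by nlinarith [sq_nonneg (ζ 0)]) hN |>.2
  have h2 : |ζ 0| ≤ ‖ζ‖ :=
    abs_le_of_sq_le_sq (by nlinarith [sq_nonneg (ζ 1), sq_nonneg (ζ 2)]) hN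
  have h3 : |(|ζ 0| - spFreq ζ)| ≤ ‖ζ‖ := by
    rw [abs_le]; constructor <;> linarith [abs_nonneg (ζ 0)]
  have e : ((1 + ‖ζ‖) ^ 2) ^ |s| = (1 + ‖ζ‖) ^ (2 * |s|) := by
    rw [← Real.rpow_natCast, ← Real.rpow_mul (by positivity)]; norm_num
  calc waveWeight s b ζ ≤ ((1 + ‖ζ‖) ^ 2) ^ |s| * (1 + ‖ζ‖) ^ |2 * b| := by
        unfold waveWeight
        gcongr
        · exact rpow_le_rpow_abs (by nlinarith) (by nlinarith) _
        · exact rpow_le_rpow_abs (by simp) (by linarith) _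
    _ ≤ _ := by
        rw [e, ← Real.rpow_add (by positivity), ← Real.rpow_natCast]
        exact Real.rpow_le_rpow_of_exponent_le (by linarith) (Nat.le_ceil _)

lemma integrable_waveWeight_mul (s b : ℝ) (u : SchwartzMap SpaceTime ℂ) :
    Integrable fun ζ => waveWeight s b ζ * ‖𝓕 (u : SpaceTime → ℂ) ζ‖ ^ 2 := by
  rw [← SchwartzMap.fourier_coe]
  set w := 𝓕 u
  set m := ⌈2 * |s| + |2 * b|⌉₊
  have hw := SchwartzMap.one_add_le_sup_seminorm_apply (𝕜 := ℝ) (m := (m, 0)) le_rfl le_rfl w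
  set K := 2 ^ (m, 0).1 * ((Finset.Iic (m, 0)).sup
    fun m => SchwartzMap.seminorm ℝ (E := SpaceTime) (F := ℂ) m.1 m.2) w
  have hm : Measurable w := w.continuous.measurable
  refine Integrable.mono' (w.integrable.norm.const_mul K) (by fun_prop)
    (Filter.Eventually.of_forall fun ζ => ?_)
  have h1 := hw ζ
  rw [norm_iteratedFDeriv_zero] at h1
  rw [Real.norm_of_nonneg (mul_nonneg (waveWeight_nonneg _ _ _) (by positivity)), sq, ← mul_assoc]
  gcongr
  exact le_trans (by gcongr; exact waveWeight_le s b ζ) h1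

lemma ofReal_integral_waveWeight (s b : ℝ) (u : SchwartzMap SpaceTime ℂ) :
    ENNReal.ofReal (∫ ζ, waveWeight s b ζ * ‖𝓕 (u : SpaceTime → ℂ) ζ‖ ^ 2) =
      ∫⁻ ζ, ENNReal.ofReal (waveWeight s b ζ) * ‖𝓕 (u : SpaceTime → ℂ) ζ‖ₑ ^ 2 := by
  rw [ofReal_integral_eq_lintegral_ofReal (integrable_waveWeight_mul s b u)
    (Filter.Eventually.of_forall fun ζ => mul_nonneg (waveWeight_nonneg _ _ _) (by positivity))]
  refine lintegral_congr fun ζ => ?_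
  rw [ENNReal.ofReal_mul (waveWeight_nonneg _ _ _), ENNReal.ofReal_pow (norm_nonneg _),
    ofReal_norm]

lemma rpow_one_add_le {a x : ℝ} (hx : 0 ≤ x) (ha : 0 ≤ a) :
    (1 + x) ^ (2 * a) ≤ 2 ^ a * (1 + x ^ 2) ^ a := by
  rw [← Real.mul_rpow (by norm_num) (by positivity), Real.rpow_mul (by positivity), Real.rpow_two]
  gcongr
  nlinarith [sq_nonneg (1 - x)]

/-- A product estimate in wave-Sobolev spaces at the level of the trilinear form. -/
theorem exists_lintegral_waveWeight_mul_le {a c β d θ : ℝ} (ha : 0 ≤ a) (hc : 0 ≤ c)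
    (hβ : 3 / 4 < β) (haβ : a ≤ β) (h3 : 2 < 3 * β - a) (hθ : 1 / 2 < θ) (hd : d < -(1 / 4)) :
    ∃ C : ℝ≥0, ∀ u v : SchwartzMap SpaceTime ℂ,
      ∫⁻ ζ, ENNReal.ofReal (waveWeight a d ζ) * ‖𝓕 (fun x => u x * v x) ζ‖ₑ ^ 2 ≤
        C * ((∫⁻ ζ, ENNReal.ofReal (waveWeight a c ζ) * ‖𝓕 (u : SpaceTime → ℂ) ζ‖ₑ ^ 2) *
          ∫⁻ ζ, ENNReal.ofReal (waveWeight β θ ζ) * ‖𝓕 (v : SpaceTime → ℂ) ζ‖ₑ ^ 2) := by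
  obtain ⟨C, hC⟩ := exists_trilinear_le ha hβ haβ h3 (b := 2 * θ) (by linarith) (k := -(2 * d))
    (by linarith)
  refine ⟨C * ((2 : ℝ) ^ a).toNNReal * ((2 : ℝ) ^ β).toNNReal, fun u v => ?_⟩
  let w := SchwartzMap.pairing (ContinuousLinearMap.mul ℂ ℂ) u v
  have hwc : 𝓕 (fun x => u x * v x) = 𝓕 (w : SpaceTime → ℂ) := rfl
  have hm : ∀ f : SchwartzMap SpaceTime ℂ, Measurable (𝓕 (f : SpaceTime → ℂ)) := fun f => by
    rw [← SchwartzMap.fourier_coe]; exact (𝓕 f).continuous.measurable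
  have hmu := hm u
  have hmv := hm v
  have hmw := hm w
  set N := ∫⁻ ζ, ENNReal.ofReal (waveWeight a d ζ) * ‖𝓕 (fun x => u x * v x) ζ‖ₑ ^ 2 with hN
  set U := ∫⁻ ζ, ENNReal.ofReal (waveWeight a c ζ) * ‖𝓕 (u : SpaceTime → ℂ) ζ‖ₑ ^ 2
  set V := ∫⁻ ζ, ENNReal.ofReal (waveWeight β θ ζ) * ‖𝓕 (v : SpaceTime → ℂ) ζ‖ₑ ^ 2
  have hNtop : N ≠ ⊤ := by
    rw [hN, hwc, ← ofReal_integral_waveWeight]; exact ENNReal.ofReal_ne_top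
  set h : SpaceTime → ℝ≥0∞ := fun ζ =>
    ENNReal.ofReal (waveWeight a d ζ) * ‖𝓕 (fun x => u x * v x) ζ‖ₑ with hh
  have hhm : Measurable h := by rw [hh, hwc]; fun_prop
  have e1 : N ≤ ∫⁻ x, ∫⁻ y, ‖𝓕 (u : SpaceTime → ℂ) x‖ₑ *
      (‖𝓕 (v : SpaceTime → ℂ) y‖ₑ * h (x + y)) := by
    calc N ≤ ∫⁻ z, ∫⁻ x, h z * (‖𝓕 (u : SpaceTime → ℂ) x‖ₑ *
          ‖𝓕 (v : SpaceTime → ℂ) (z - x)‖ₑ) := by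
          refine lintegral_mono fun z => ?_
          rw [lintegral_const_mul _ (by fun_prop), sq, ← mul_assoc]
          refine mul_le_mul_right ?_ _
          rw [fourier_mul_apply]
          refine (enorm_integral_le_lintegral_enorm _).trans_eq ?_
          simp only [enorm_mul]
      _ = _ := by
          rw [lintegral_lintegral_swap (by fun_prop)]
          refine lintegral_congr fun x => ?_
          rw [← lintegral_sub_right_eq_self (fun y => ‖𝓕 (u : SpaceTime → ℂ) x‖ₑ *
            (‖𝓕 (v : SpaceTime → ℂ) y‖ₑ * h (x + y))) x]
          refine lintegral_congr fun z => ?_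
          rw [add_sub_cancel]
          ring
  have e2 := hC _ _ h hmu.enorm hmv.enorm hhm
  have bU : ∫⁻ x, ‖𝓕 (u : SpaceTime → ℂ) x‖ₑ ^ 2 * jap (-(2 * a)) (spFreq x) ≤
      ENNReal.ofReal (2 ^ a) * U := by
    rw [← lintegral_const_mul _ (by fun_prop)]
    refine lintegral_mono fun x => ?_
    rw [mul_comm, ← mul_assoc]
    gcongr
    rw [jap_spFreq, neg_neg, ← ENNReal.ofReal_mul (by positivity)]
    refine ENNReal.ofReal_le_ofReal ((rpow_one_add_le (spFreq_nonneg x) ha).trans ?_)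
    unfold waveWeight
    gcongr
    exact le_mul_of_one_le_right (by positivity) (Real.one_le_rpow (by simp) (by linarith))
  have bV : ∫⁻ x, ‖𝓕 (v : SpaceTime → ℂ) x‖ₑ ^ 2 *
      (jap (-(2 * β)) (spFreq x) * coneJap (-(2 * θ)) x) ≤ ENNReal.ofReal (2 ^ β) * V := by
    rw [← lintegral_const_mul _ (by fun_prop)]
    refine lintegral_mono fun x => ?_
    rw [mul_comm, ← mul_assoc]
    gcongr ?_ * _
    have := spFreq_nonneg x
    rw [jap_spFreq, coneJap, jap, neg_neg, neg_neg, ← ENNReal.ofReal_mul (by positivity),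
      ← ENNReal.ofReal_mul (by positivity)]
    refine ENNReal.ofReal_le_ofReal ?_
    rw [waveWeight, ← mul_assoc]
    gcongr
    exact rpow_one_add_le (spFreq_nonneg x) (by linarith)
  have bN : ∫⁻ x, h x ^ 2 * (jap (2 * a) (spFreq x) * coneJap (-(-(2 * d))) x) ≤ N := by
    refine lintegral_mono fun x => ?_
    have h1 : ENNReal.ofReal (waveWeight a d x) *
        (jap (2 * a) (spFreq x) * coneJap (-(-(2 * d))) x) ≤ 1 := by
      have := spFreq_nonneg x
      rw [jap_spFreq, coneJap, jap, neg_neg, ← ENNReal.ofReal_mul (by positivity),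
        ← ENNReal.ofReal_mul (waveWeight_nonneg _ _ _), ENNReal.ofReal_le_one]
      rw [waveWeight, mul_mul_mul_comm, ← Real.rpow_add (by positivity), add_neg_cancel,
        Real.rpow_zero, mul_one, Real.rpow_neg (by positivity), ← div_eq_mul_inv]
      refine div_le_one_of_le₀ ?_ (by positivity)
      rw [Real.rpow_mul (by positivity), Real.rpow_two]
      gcongr
      nlinarith
    calc _ = ENNReal.ofReal (waveWeight a d x) * ‖𝓕 (fun x => u x * v x) x‖ₑ ^ 2 *
          (ENNReal.ofReal (waveWeight a d x) *
            (jap (2 * a) (spFreq x) * coneJap (-(-(2 * d))) x)) := by rw [hh]; ring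
      _ ≤ _ := mul_le_of_le_one_right' h1
  have e3 : N * N ≤ N * (C * ((ENNReal.ofReal (2 ^ a) * U) * (ENNReal.ofReal (2 ^ β) * V))) :=
    calc N * N ≤ _ := by rw [← sq]; exact pow_le_pow_left' e1 2
      _ ≤ _ := e2
      _ ≤ C * ((ENNReal.ofReal (2 ^ a) * U) * (ENNReal.ofReal (2 ^ β) * V) * N) := by gcongr
      _ = _ := by ring
  rcases eq_or_ne N 0 with h0 | h0
  · rw [h0]; exact zero_le
  · rw [ENNReal.mul_le_mul_iff_right h0 hNtop] at e3
    refine e3.trans_eq ?_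
    push_cast
    rw [ENNReal.ofReal, ENNReal.ofReal]
    ring

theorem nullphi_high_estimate_2 (s s' θ₀ θ₁ : ℝ)
    (hs1 : 1/4 < s') (hs2 : s' ≤ 1) (hs3 : 1/2 < s) (hs4 : s ≤ 1)
    (hs5 : max (3/2 - 2 * s) (s/2 - 1/8) < s') (hs6 : s' < 4 * s - 3/2)
    (hθ0 : 1/2 < θ₀) (hθ0b : θ₀ < 3/4)
    (hθ1 : max (1/2) (1 - s') < θ₁)
    (hθ1b : θ₁ < min (3/4) (min (4 * s - s' - 1) (2 * s - 1/2))) :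
    ∃ ε₀ > 0, ∀ ε : ℝ, 0 < ε → ε ≤ ε₀ → ∃ C > 0, ∀ u v : SchwartzMap SpaceTime ℂ,
      waveNorm (s - 1/2) (θ₀ - 1 + ε) (fun x => u x * v x) ≤
        C * waveNorm (s - 1/2) (θ₀ - 1/2) (fun x => u x) *
          waveNorm (s' + 1/2) θ₁ (fun x => v x) := by
  rw [max_lt_iff] at hs5 hθ1
  refine ⟨(3 / 4 - θ₀) / 2, by linarith, fun ε hε hε₀ => ?_⟩
  obtain ⟨C, hC⟩ := exists_lintegral_waveWeight_mul_le (a := s - 1 / 2) (c := θ₀ - 1 / 2)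
    (β := s' + 1 / 2) (d := θ₀ - 1 + ε) (θ := θ₁) (by linarith) (by linarith) (by linarith)
    (by linarith) (by linarith) hθ1.1 (by linarith)
  refine ⟨((C : ℝ) + 1) ^ (1 / 2 : ℝ), by positivity, fun u v => ?_⟩
  have h := hC u v
  have hnn : ∀ (s b : ℝ) (f : SpaceTime → ℂ), 0 ≤ ∫ ζ, waveWeight s b ζ * ‖𝓕 f ζ‖ ^ 2 :=
    fun s b f => integral_nonneg fun ζ => mul_nonneg (waveWeight_nonneg _ _ _) (by positivity)
  have hw :
      ∫⁻ ζ, ENNReal.ofReal (waveWeight (s - 1 / 2) (θ₀ - 1 + ε) ζ) *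
        ‖𝓕 (fun x => u x * v x) ζ‖ₑ ^ 2 =
      ENNReal.ofReal (∫ ζ, waveWeight (s - 1 / 2) (θ₀ - 1 + ε) ζ *
        ‖𝓕 (fun x => u x * v x) ζ‖ ^ 2) := (ofReal_integral_waveWeight (s - 1 / 2) (θ₀ - 1 + ε)
    (SchwartzMap.pairing (ContinuousLinearMap.mul ℂ ℂ) u v)).symm
  rw [← ofReal_integral_waveWeight, ← ofReal_integral_waveWeight, hw,
    ← ENNReal.ofReal_mul (hnn _ _ _), ← ENNReal.ofReal_coe_nnreal,
    ← ENNReal.ofReal_mul (by positivity),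
    ENNReal.ofReal_le_ofReal_iff (mul_nonneg C.coe_nonneg (mul_nonneg (hnn _ _ _) (hnn _ _ _)))] at h
  change (∫ ζ, waveWeight _ _ ζ * _) ^ (1 / 2 : ℝ) ≤ _ * (∫ ζ, waveWeight _ _ ζ * _) ^ (1 / 2 : ℝ) *
    (∫ ζ, waveWeight _ _ ζ * _) ^ (1 / 2 : ℝ)
  rw [← Real.mul_rpow (by positivity) (hnn _ _ _), ← Real.mul_rpow
    (mul_nonneg (by positivity) (hnn _ _ _)) (hnn _ _ _), mul_assoc]
  refine Real.rpow_le_rpow (hnn _ _ _) (h.trans ?_) (by norm_num)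
  exact mul_le_mul_of_nonneg_right (by linarith) (mul_nonneg (hnn _ _ _) (hnn _ _ _))

end
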